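/- arXiv:2110.13019 — 4 statements merged into one kernel-verified Lean document; each statement's English description precedes it below -/
import Mathlib

section
/- Let W and W̃ be N×N discrete matrix weights and let Φ, Ψ be matrix polynomials with deg Φ ≤ 2 and deg Ψ ≤ 1 such that W̃(x) = W(x)Φ(x) and W̃(x) − W̃(x−1) = W(x)Ψ(x) for all x ∈ ℤ. Let (P_n) and (P̃_n) be the monic orthogonal sequences of W and W̃ respectively. Then the forward difference Δ acts as a backward shift: for every n ≥ 1, P_n(x+1) − P_n(x) = n·P̃_{n−1}(x) as an identity of matrix polynomials (valid for all x ∈ ℂ). -/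
open scoped BigOperators ComplexOrder
open Matrix Polynomial Filter

noncomputable section

/-- The space of `N × N` complex matrices. -/
abbrev Mat (N : ℕ) := Matrix (Fin N) (Fin N) ℂ

/-- Evaluation of a matrix polynomial at a (scalar) complex number. -/
def matEval {N : ℕ} (P : Polynomial (Mat N)) (z : ℂ) : Mat N :=
  P.eval (z • (1 : Mat N))

/-- Matrix-valued inner product associated to a discrete matrix weight:
`⟨P,Q⟩_W = ∑_{x=0}^∞ P(x) W(x) Q(x)^*`. -/
def innerW {N : ℕ} (W : ℤ → Mat N) (P Q : Polynomial (Mat N)) : Mat N :=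
  ∑' x : ℕ, matEval P x * W x * (matEval Q x)ᴴ

/-- `W : ℤ → M_N(ℂ)` is an `N × N` discrete matrix weight: positive definite on ℕ,
zero on negative integers, with entrywise absolutely convergent moments of all orders. -/
structure IsWeight {N : ℕ} (W : ℤ → Mat N) : Prop where
  posDef : ∀ x : ℕ, (W (x : ℤ)).PosDef
  neg : ∀ x : ℤ, x < 0 → W x = 0
  moments : ∀ k : ℕ, ∀ i j : Fin N, Summable fun x : ℕ => (x : ℝ) ^ k * ‖W (x : ℤ) i j‖

/-- `P` is the monic orthogonal sequence of the discrete matrix weight `W`. -/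
structure IsMOS {N : ℕ} (W : ℤ → Mat N) (P : ℕ → Polynomial (Mat N)) : Prop where
  monic : ∀ n, (P n).Monic
  deg : ∀ n, (P n).natDegree = n
  orth : ∀ m n, m ≠ n → innerW W (P m) (P n) = 0

/-- Left evaluation `Q⟦M⟧ = ∑_k M^k * A_k` of a matrix polynomial at a matrix. -/
def leftEval {N : ℕ} (Q : Polynomial (Mat N)) (M : Mat N) : Mat N :=
  Q.sum fun k a => M ^ k * a

/-- The block Vandermonde condition for an eigenvalue function `ρ`. -/
def BlockVdm {N : ℕ} (ρ : ℕ → Mat N) : Prop :=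
  ∀ x : ℕ, ∃ k : Fin (x + 1) → ℕ,
    IsUnit (Matrix.of fun p q : Fin (x + 1) × Fin N => (ρ (k p.1) ^ (q.1 : ℕ)) p.2 q.2)

/-- The backward difference operator `(G·∇)(x) = G(x) - G(x-1)`. -/
def nabla {N : ℕ} (G : ℤ → Mat N) : ℤ → Mat N := fun x => G x - G (x - 1)

lemma matEval_zero {N : ℕ} (z : ℂ) : matEval (0 : Polynomial (Mat N)) z = 0 := by
  simp [matEval]

lemma matEval_add {N : ℕ} (P Q : Polynomial (Mat N)) (z : ℂ) :
    matEval (P + Q) z = matEval P z + matEval Q z := by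
  simp [matEval]

lemma matEval_sub {N : ℕ} (P Q : Polynomial (Mat N)) (z : ℂ) :
    matEval (P - Q) z = matEval P z - matEval Q z := by
  simp [matEval]

/-- Scalar matrices are central, so evaluation at a scalar is multiplicative. -/
lemma matEval_mul {N : ℕ} (P Q : Polynomial (Mat N)) (z : ℂ) :
    matEval (P * Q) z = matEval P z * matEval Q z := by
  have h : ∀ R : Polynomial (Mat N), matEval R z =
      eval₂RingHom' (RingHom.id (Mat N)) (z • (1 : Mat N))
        (fun a => by simp [Commute, SemiconjBy]) R := fun R => rfl
  rw [h, h, h, map_mul]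

lemma matEval_C {N : ℕ} (A : Mat N) (z : ℂ) : matEval (C A) z = A := by
  simp [matEval]

lemma matEval_X_pow {N : ℕ} (k : ℕ) (z : ℂ) :
    matEval (X ^ k : Polynomial (Mat N)) z = z ^ k • (1 : Mat N) := by
  induction k with
  | zero => simp [matEval]
  | succ k ih =>
    rw [pow_succ, matEval_mul, ih]
    simp [matEval, pow_succ, mul_smul, smul_comm z]

lemma matEval_X_add_one_pow {N : ℕ} (k : ℕ) (z : ℂ) :
    matEval ((X + 1) ^ k : Polynomial (Mat N)) z = (z + 1) ^ k • (1 : Mat N) := by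
  induction k with
  | zero => simp [matEval]
  | succ k ih =>
    rw [pow_succ, matEval_mul, ih]
    simp [matEval, pow_succ, add_smul, mul_add, mul_smul, smul_comm z]

lemma matEval_X_sub_C_one_pow {N : ℕ} (k : ℕ) (z : ℂ) :
    matEval ((X - C 1) ^ k : Polynomial (Mat N)) z = (z - 1) ^ k • (1 : Mat N) := by
  induction k with
  | zero => simp [matEval]
  | succ k ih =>
    rw [pow_succ, matEval_mul, ih]
    simp [matEval, pow_succ, sub_smul, mul_sub, mul_smul, smul_comm z]

lemma matEval_sum {N : ℕ} {ι : Type*} (s : Finset ι) (f : ι → Polynomial (Mat N)) (z : ℂ) :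
    matEval (∑ i ∈ s, f i) z = ∑ i ∈ s, matEval (f i) z := by
  simp [matEval, eval_finsetSum]

lemma matEval_eq_sum {N : ℕ} (P : Polynomial (Mat N)) (z : ℂ) :
    matEval P z = ∑ k ∈ Finset.range (P.natDegree + 1), z ^ k • P.coeff k := by
  simp [matEval, eval_eq_sum_range, _root_.smul_pow]

lemma matEval_eq_zero_of_forall_nat {N : ℕ} (P : Polynomial (Mat N))
    (h : ∀ x : ℕ, matEval P x = 0) (z : ℂ) : matEval P z = 0 := by
  ext i j
  let p : ℂ[X] := ∑ k ∈ Finset.range (P.natDegree + 1), C (P.coeff k i j) * X ^ k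
  have hp : ∀ w, p.eval w = matEval P w i j := fun w => by
    simp only [p, matEval_eq_sum, eval_finsetSum, Matrix.sum_apply, Matrix.smul_apply, eval_mul,
      eval_C, eval_pow, eval_X, smul_eq_mul]
    exact Finset.sum_congr rfl fun k _ => mul_comm _ _
  have hp0 : p = 0 := by
    refine eq_zero_of_infinite_isRoot p (Set.Infinite.mono ?_
      (Set.infinite_range_of_injective (Nat.cast_injective (R := ℂ))))
    rintro _ ⟨x, rfl⟩
    simp [IsRoot, hp, h]
  rw [← hp, hp0]
  simp

/-- The pointwise conjugate transpose on `ℕ` of a matrix polynomial is a matrix polynomial. -/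
lemma exists_matEval_eq_conjTranspose {N : ℕ} (Q : Polynomial (Mat N)) :
    ∃ R : Polynomial (Mat N), R.natDegree ≤ Q.natDegree ∧
      ∀ x : ℕ, matEval R x = (matEval Q x)ᴴ := by
  refine ⟨∑ k ∈ Finset.range (Q.natDegree + 1), C (Q.coeff k)ᴴ * X ^ k, ?_, fun x => ?_⟩
  · refine natDegree_sum_le_of_forall_le _ _ fun k hk => ?_
    exact (natDegree_C_mul_X_pow_le _ _).trans (by simpa [Nat.lt_succ_iff] using hk)
  · simp [matEval_eq_sum Q, matEval_sum, matEval_mul, matEval_C, matEval_X_pow,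
      conjTranspose_sum]

lemma IsWeight.summable_smul {N : ℕ} {W : ℤ → Mat N} (hW : IsWeight W) (k : ℕ) :
    Summable fun x : ℕ => (x : ℂ) ^ k • W x := by
  refine Pi.summable.2 fun i => Pi.summable.2 fun j => ?_
  refine Summable.of_norm ((hW.moments k i j).congr fun x => ?_)
  simp

lemma IsWeight.summable_inner {N : ℕ} {W : ℤ → Mat N} (hW : IsWeight W)
    (P Q : Polynomial (Mat N)) :
    Summable fun x : ℕ => matEval P x * W x * (matEval Q x)ᴴ := by
  have h : ∀ x : ℕ, matEval P x * W x * (matEval Q x)ᴴ =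
      ∑ k ∈ Finset.range (P.natDegree + 1), ∑ l ∈ Finset.range (Q.natDegree + 1),
        P.coeff k * ((x : ℂ) ^ (k + l) • W x) * (Q.coeff l)ᴴ := fun x => by
    rw [matEval_eq_sum, matEval_eq_sum, conjTranspose_sum, Finset.sum_mul, Finset.sum_mul]
    refine Finset.sum_congr rfl fun k _ => ?_
    rw [Finset.mul_sum]
    refine Finset.sum_congr rfl fun l _ => ?_
    simp [pow_add, mul_smul, smul_comm ((x : ℂ) ^ l)]
  simp only [h]
  exact summable_sum fun k _ => summable_sum fun l _ =>
    ((hW.summable_smul (k + l)).mul_left _).mul_right _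

lemma IsWeight.innerW_add_right {N : ℕ} {W : ℤ → Mat N} (hW : IsWeight W)
    (P Q R : Polynomial (Mat N)) : innerW W P (Q + R) = innerW W P Q + innerW W P R := by
  rw [innerW, innerW, innerW, ← (hW.summable_inner P Q).tsum_add (hW.summable_inner P R)]
  simp [matEval_add, mul_add]

lemma IsWeight.innerW_sub_left {N : ℕ} {W : ℤ → Mat N} (hW : IsWeight W)
    (P Q R : Polynomial (Mat N)) : innerW W (P - Q) R = innerW W P R - innerW W Q R := by
  rw [innerW, innerW, innerW, ← (hW.summable_inner P R).tsum_sub (hW.summable_inner Q R)]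
  simp [matEval_sub, sub_mul]

lemma IsWeight.innerW_C_mul_left {N : ℕ} {W : ℤ → Mat N} (hW : IsWeight W)
    (A : Mat N) (P Q : Polynomial (Mat N)) : innerW W (C A * P) Q = A * innerW W P Q := by
  rw [innerW, innerW, ← (hW.summable_inner P Q).tsum_mul_left]
  simp [matEval_mul, matEval_C, mul_assoc]

lemma IsWeight.innerW_C_mul_right {N : ℕ} {W : ℤ → Mat N} (hW : IsWeight W)
    (A : Mat N) (P Q : Polynomial (Mat N)) : innerW W P (C A * Q) = innerW W P Q * Aᴴ := by
  rw [innerW, innerW, ← (hW.summable_inner P Q).tsum_mul_right]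
  simp [matEval_mul, matEval_C, mul_assoc]

lemma innerW_zero_right {N : ℕ} (W : ℤ → Mat N) (P : Polynomial (Mat N)) :
    innerW W P 0 = 0 := by
  simp [innerW, matEval_zero]

/-- A matrix polynomial orthogonal to a family `B k` of monic polynomials of degree `k`, `k < n`,
is orthogonal to all matrix polynomials of degree less than `n`. -/
lemma IsWeight.innerW_eq_zero_of_degree_lt {N : ℕ} {W : ℤ → Mat N} (hW : IsWeight W)
    {P : Polynomial (Mat N)} {B : ℕ → Polynomial (Mat N)} (hB : ∀ k, (B k).Monic)
    (hBd : ∀ k, (B k).degree = k) {n : ℕ} (h : ∀ k < n, innerW W P (B k) = 0)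
    {R : Polynomial (Mat N)} (hR : R.degree < n) : innerW W P R = 0 := by
  induction n generalizing R with
  | zero =>
    have : R = 0 := by simpa using hR
    rw [this, innerW_zero_right]
  | succ n ih =>
    have hlt : (R - C (R.coeff n) * B n).degree < n := by
      refine (degree_lt_iff_coeff_zero _ _).2 fun m hm => ?_
      rcases hm.eq_or_lt with rfl | hm
      · have hc : (B n).coeff n = 1 := by
          have := hB n
          rwa [Monic, leadingCoeff, natDegree_eq_of_degree_eq_some (hBd n)] at this
        simp [hc]
      · have h1 : R.coeff m = 0 := (degree_lt_iff_coeff_zero _ _).1 hR m hm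
        have h2 : (B n).coeff m = 0 :=
          coeff_eq_zero_of_degree_lt (by rw [hBd]; exact_mod_cast hm)
        simp [h1, h2]
    have := hW.innerW_add_right P (R - C (R.coeff n) * B n) (C (R.coeff n) * B n)
    rw [sub_add_cancel, hW.innerW_C_mul_right, h n n.lt_succ_self,
      ih (fun k hk => h k (hk.trans n.lt_succ_self)) hlt] at this
    simpa using this

lemma IsMOS.innerW_eq_zero {N : ℕ} [NeZero N] {W : ℤ → Mat N} (hW : IsWeight W)
    {P : ℕ → Polynomial (Mat N)} (hP : IsMOS W P) {n : ℕ} {R : Polynomial (Mat N)}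
    (hR : R.degree < n) : innerW W (P n) R = 0 :=
  hW.innerW_eq_zero_of_degree_lt hP.monic
    (fun k => by rw [degree_eq_natDegree (hP.monic k).ne_zero, hP.deg])
    (fun k hk => hP.orth n k hk.ne') hR

/-- Definiteness of the inner product. -/
lemma IsWeight.matEval_eq_zero_of_innerW_self {N : ℕ} {W : ℤ → Mat N} (hW : IsWeight W)
    {P : Polynomial (Mat N)} (h : innerW W P P = 0) (z : ℂ) : matEval P z = 0 := by
  refine matEval_eq_zero_of_forall_nat P (fun x => ?_) z
  have hs : HasSum (fun x : ℕ => matEval P x * W x * (matEval P x)ᴴ) 0 :=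
    h ▸ (hW.summable_inner P P).hasSum
  ext i j
  have hform : ∀ x : ℕ, (matEval P x * W x * (matEval P x)ᴴ) i i =
      star (star (matEval P x i)) ⬝ᵥ (W x *ᵥ star (matEval P x i)) := fun x => by
    rw [mul_assoc, star_star]
    simp [Matrix.mul_apply, dotProduct, mulVec]
  have hi := Complex.hasSum_re (Pi.hasSum.1 (Pi.hasSum.1 hs i) i)
  have hnn : ∀ x : ℕ, 0 ≤ ((matEval P x * W x * (matEval P x)ᴴ) i i).re := fun x => by
    rw [hform]
    exact (Complex.le_def.1 ((hW.posDef x).posSemidef.dotProduct_mulVec_nonneg _)).1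
  have h0 := congrFun ((hasSum_zero_iff_of_nonneg hnn).1 hi) x
  by_contra hne
  have hv : star (matEval P x i) ≠ 0 := fun hv => hne (by
    have := congrFun hv j
    simpa using this)
  have hpos := (Complex.lt_def.1 ((hW.posDef x).dotProduct_mulVec_pos hv)).1
  rw [← hform] at hpos
  exact hpos.ne' h0

/-- The forward difference `P(X + 1) - P(X)` of a matrix polynomial. -/
def forwardDiff {N : ℕ} (P : Polynomial (Mat N)) : Polynomial (Mat N) :=
  ∑ k ∈ Finset.range (P.natDegree + 1), C (P.coeff k) * ((X + 1) ^ k - X ^ k)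

lemma matEval_forwardDiff {N : ℕ} (P : Polynomial (Mat N)) (z : ℂ) :
    matEval (forwardDiff P) z = matEval P (z + 1) - matEval P z := by
  rw [matEval_eq_sum P, matEval_eq_sum P, ← Finset.sum_sub_distrib, forwardDiff, matEval_sum]
  refine Finset.sum_congr rfl fun k _ => ?_
  simp [matEval_mul, matEval_C, matEval_sub, matEval_X_pow, matEval_X_add_one_pow, mul_sub]

lemma coeff_forwardDiff {N : ℕ} (P : Polynomial (Mat N)) (j : ℕ) :
    (forwardDiff P).coeff j = ∑ k ∈ Finset.range (P.natDegree + 1),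
      P.coeff k * ((k.choose j : Mat N) - if j = k then 1 else 0) := by
  simp only [forwardDiff, finsetSum_coeff, coeff_C_mul, coeff_sub, coeff_X_add_one_pow,
    coeff_X_pow]

/-- Summation by parts. -/
lemma innerW_forwardDiff {N : ℕ} {W Wt : ℤ → Mat N} (hWt : IsWeight Wt)
    (P Q S : Polynomial (Mat N))
    (hS : ∀ x : ℕ, Wt (x - 1) * (matEval Q (x - 1))ᴴ - Wt x * (matEval Q x)ᴴ =
      -(W x * (matEval S x)ᴴ)) :
    innerW Wt (forwardDiff P) Q = -innerW W P S := by
  let f : ℕ → Mat N := fun x => matEval P x * (Wt (x - 1) * (matEval Q (x - 1))ᴴ)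
  have hf0 : f 0 = 0 := by simp [f, hWt.neg (-1) (by norm_num)]
  have hf1 : ∀ x : ℕ, f (x + 1) = matEval (forwardDiff P + P) x * Wt x * (matEval Q x)ᴴ :=
    fun x => by simp [f, matEval_add, matEval_forwardDiff, mul_assoc]
  have hfs : Summable f := (summable_nat_add_iff 1).1 <| by
    simpa only [hf1] using hWt.summable_inner (forwardDiff P + P) Q
  have hft : ∑' x, f x = innerW Wt (forwardDiff P + P) Q := by
    rw [hfs.tsum_eq_zero_add, hf0, zero_add, innerW]
    simp only [hf1]
  have : innerW Wt (forwardDiff P) Q = ∑' x, f x - innerW Wt P Q := by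
    rw [hft, ← hWt.innerW_sub_left, add_sub_cancel_right]
  rw [this, innerW, innerW, ← hfs.tsum_sub (hWt.summable_inner P Q), ← tsum_neg]
  refine tsum_congr fun x => ?_
  simp only [f, mul_assoc]
  rw [← mul_sub, hS, mul_neg]

lemma degree_X_pow_sub_X_sub_one_pow_lt {N : ℕ} [NeZero N] (k : ℕ) :
    (X ^ k - (X - C 1) ^ k : Polynomial (Mat N)).degree < k := by
  have h : ((X - C 1) ^ k : Polynomial (Mat N)).Monic := (monic_X_sub_C _).pow k
  have hd : ((X - C 1) ^ k : Polynomial (Mat N)).degree = k := by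
    rw [degree_eq_natDegree h.ne_zero, (monic_X_sub_C _).natDegree_pow, natDegree_X_sub_C, mul_one]
  have := degree_sub_lt_left (p := (X ^ k : Polynomial (Mat N))) (q := (X - C 1) ^ k)
    (by rw [hd, degree_X_pow]) (monic_X_pow k).ne_zero
    (by rw [h.leadingCoeff, (monic_X_pow k).leadingCoeff])
  rwa [degree_X_pow] at this

lemma Polynomial.Monic.coeff_forwardDiff_of_le {N m : ℕ} {P : Polynomial (Mat N)} (hP : P.Monic)
    (hd : P.natDegree = m + 1) {j : ℕ} (hj : m ≤ j) :
    (forwardDiff P).coeff j = if j = m then ((m + 1 : ℕ) : Mat N) else 0 := by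
  have hc : P.coeff (m + 1) = 1 := hd ▸ hP
  rw [coeff_forwardDiff, hd, Finset.sum_range_succ, Finset.sum_eq_zero, hc, zero_add, one_mul]
  · rcases hj.eq_or_lt with rfl | hj
    · simp
    · rcases (Nat.succ_le_of_lt hj).eq_or_lt with rfl | hj'
      · simp
      · simp [Nat.choose_eq_zero_of_lt hj', hj.ne', hj'.ne']
  · intro k hk
    have hk : k ≤ j := (Nat.lt_succ_iff.1 (Finset.mem_range.1 hk)).trans hj
    rcases hk.eq_or_lt with rfl | hk
    · simp
    · simp [Nat.choose_eq_zero_of_lt hk, hk.ne']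

/-- Under the Pearson equations, the forward difference of a polynomial orthogonal with respect
to `W` to lower degrees is orthogonal with respect to `Wt` to the monomials of lower degree. -/
lemma innerW_forwardDiff_X_pow_eq_zero {N : ℕ} [NeZero N] {W Wt : ℤ → Mat N} (hWt : IsWeight Wt)
    {Φ Ψ : Polynomial (Mat N)} (hΦ : Φ.natDegree ≤ 2) (hΨ : Ψ.natDegree ≤ 1)
    (h1 : ∀ x : ℤ, Wt x = W x * matEval Φ (x : ℂ))
    (h2 : ∀ x : ℤ, Wt x - Wt (x - 1) = W x * matEval Ψ (x : ℂ))
    {P : Polynomial (Mat N)} {m : ℕ}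
    (hP : ∀ R : Polynomial (Mat N), R.degree < (m + 1 : ℕ) → innerW W P R = 0)
    {k : ℕ} (hk : k < m) : innerW Wt (forwardDiff P) (X ^ k) = 0 := by
  obtain ⟨Φ', hΦd, hΦ'⟩ := exists_matEval_eq_conjTranspose Φ
  obtain ⟨Ψ', hΨd, hΨ'⟩ := exists_matEval_eq_conjTranspose Ψ
  rw [innerW_forwardDiff hWt P (X ^ k) ((X - C 1) ^ k * Ψ' + (X ^ k - (X - C 1) ^ k) * Φ'),
    hP, neg_zero]
  · refine (degree_add_le _ _).trans_lt (max_lt ?_ ?_)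
    · refine degree_le_natDegree.trans_lt (Nat.cast_lt.2 ?_)
      have := natDegree_mul_le (p := (X - C 1 : Polynomial (Mat N)) ^ k) (q := Ψ')
      rw [(monic_X_sub_C _).natDegree_pow, natDegree_X_sub_C] at this
      lia
    · by_cases h0 : (X ^ k - (X - C 1) ^ k : Polynomial (Mat N)) = 0
      · rw [h0, zero_mul, degree_zero]
        exact WithBot.bot_lt_coe _
      · refine degree_le_natDegree.trans_lt (Nat.cast_lt.2 ?_)
        have hlt := (natDegree_lt_iff_degree_lt h0).2 (degree_X_pow_sub_X_sub_one_pow_lt k)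
        have := natDegree_mul_le (p := (X ^ k - (X - C 1) ^ k : Polynomial (Mat N))) (q := Φ')
        lia
  · intro x
    have e1 : Wt x = W x * matEval Φ (x : ℂ) := by simpa using h1 x
    have e2 : Wt (x - 1) = W x * matEval Φ (x : ℂ) - W x * matEval Ψ (x : ℂ) := by
      have h := h2 x
      rw [Int.cast_natCast] at h
      rw [← e1, ← h, sub_sub_cancel]
    rw [e2, e1]
    simp only [matEval_add, matEval_mul, matEval_sub, matEval_X_pow, matEval_X_sub_C_one_pow,
      hΦ', hΨ', conjTranspose_add, conjTranspose_mul, conjTranspose_sub, conjTranspose_smul,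
      conjTranspose_one, conjTranspose_conjTranspose, mul_add, mul_sub, mul_smul_comm, mul_one,
      smul_sub]
    abel

/-- under strong Pearson equations the forward difference is a backward
shift operator: `P_n(x+1) - P_n(x) = n · P̃_{n-1}(x)`. -/
theorem forward_difference_is_backward_shift {N : ℕ} (W Wt : ℤ → Mat N)
    (hW : IsWeight W) (hWt : IsWeight Wt)
    (Φ Ψ : Polynomial (Mat N)) (hΦ : Φ.natDegree ≤ 2) (hΨ : Ψ.natDegree ≤ 1)
    (h1 : ∀ x : ℤ, Wt x = W x * matEval Φ (x : ℂ))
    (h2 : ∀ x : ℤ, Wt x - Wt (x - 1) = W x * matEval Ψ (x : ℂ))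
    (P Pt : ℕ → Polynomial (Mat N)) (hP : IsMOS W P) (hPt : IsMOS Wt Pt) :
    ∀ n : ℕ, 1 ≤ n → ∀ z : ℂ,
      matEval (P n) (z + 1) - matEval (P n) z = (n : ℂ) • matEval (Pt (n - 1)) z := by
  obtain rfl | hN := N.eq_zero_or_pos
  · exact fun _ _ _ => Subsingleton.elim _ _
  have : NeZero N := ⟨hN.ne'⟩
  rintro n hn z
  obtain ⟨m, rfl⟩ := Nat.exists_eq_add_of_le' hn
  rw [Nat.add_sub_cancel]
  set D := forwardDiff (P (m + 1)) - C ((m + 1 : ℕ) : Mat N) * Pt m with hD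
  have hdeg : D.degree < m := by
    refine (degree_lt_iff_coeff_zero _ _).2 fun j hj => ?_
    rw [hD, coeff_sub, coeff_C_mul, (hP.monic _).coeff_forwardDiff_of_le (hP.deg _) hj]
    rcases hj.eq_or_lt with rfl | hj
    · have hc : (Pt m).coeff m = 1 := by
        simpa [Monic, leadingCoeff, hPt.deg] using hPt.monic m
      simp [hc]
    · simp [hj.ne', coeff_eq_zero_of_natDegree_lt ((hPt.deg m).trans_lt hj)]
  have horth : innerW Wt D D = 0 := by
    have h := hWt.innerW_eq_zero_of_degree_lt (P := forwardDiff (P (m + 1)))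
      (fun k => monic_X_pow k) degree_X_pow
      (fun k hk => innerW_forwardDiff_X_pow_eq_zero hWt hΦ hΨ h1 h2
        (fun R hR => hP.innerW_eq_zero hW hR) hk) hdeg
    nth_rewrite 1 [hD]
    rw [hWt.innerW_sub_left, hWt.innerW_C_mul_left, h, hPt.innerW_eq_zero hWt hdeg, mul_zero,
      sub_zero]
  have h0 := hWt.matEval_eq_zero_of_innerW_self horth z
  rw [hD, matEval_sub, matEval_forwardDiff, matEval_mul, matEval_C, sub_eq_zero] at h0
  rw [h0, ← nsmul_eq_mul, Nat.cast_smul_eq_nsmul]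
end
end

section
/- Let (W^{(λ)})_{λ∈ℕ₀} be a family of N×N discrete matrix weights satisfying strong Pearson equations, with monic orthogonal sequences (P_n^{(λ)}) and matrices G_n^{(λ)} = −(n−1)(K_2^{(λ)})^* − (J_1^{(λ)})^*. Then the Rodrigues formula holds: for all n, λ ∈ ℕ₀ and all x ∈ ℤ, G_1^{(λ+n−1)}·G_2^{(λ+n−2)} ⋯ G_n^{(λ)}·P_n^{(λ)}(x)·W^{(λ)}(x) = (−1)^n·(W^{(λ+n)}·∇^n)(x), where ∇ is the backward difference operator (G·∇)(x) = G(x) − G(x−1), applied n times to the function W^{(λ+n)}. -/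
open scoped BigOperators ComplexOrder
open Matrix Polynomial Filter

noncomputable section

/-- Matrix-valued functions on `ℤ` that are polynomial of degree less than `n`. -/
def polyLT (N n : ℕ) : Submodule ℂ (ℤ → Mat N) :=
  Submodule.span ℂ {f | ∃ k < n, ∃ A : Mat N, f = fun x : ℤ => (x : ℂ) ^ k • A}

section polyLT

variable {N n m k : ℕ} {f g : ℤ → Mat N}

theorem pow_smul_mem_polyLT (h : k < n) (A : Mat N) :
    (fun x : ℤ => (x : ℂ) ^ k • A) ∈ polyLT N n :=
  Submodule.subset_span ⟨k, h, A, rfl⟩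

theorem zero_mem_polyLT : (fun _ => 0) ∈ polyLT N n :=
  (polyLT N n).zero_mem

theorem polyLT_mono (h : n ≤ m) (hf : f ∈ polyLT N n) : f ∈ polyLT N m := by
  refine Submodule.span_mono ?_ hf
  rintro _ ⟨k, hk, A, rfl⟩
  exact ⟨k, hk.trans_le h, A, rfl⟩

/-- A linear map sends `polyLT N n` into a submodule once it does so on monomials. -/
theorem map_mem_of_mem_polyLT (L : (ℤ → Mat N) →ₗ[ℂ] (ℤ → Mat N))
    {S : Submodule ℂ (ℤ → Mat N)}
    (h : ∀ k < n, ∀ A : Mat N, L (fun x : ℤ => (x : ℂ) ^ k • A) ∈ S)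
    (hf : f ∈ polyLT N n) : L f ∈ S := by
  have : polyLT N n ≤ S.comap L := by
    refine Submodule.span_le.2 ?_
    rintro _ ⟨k, hk, A, rfl⟩
    exact h k hk A
  exact this hf

theorem const_mul_mem_polyLT (B : Mat N) (hf : f ∈ polyLT N n) :
    (fun x => B * f x) ∈ polyLT N n := by
  refine map_mem_of_mem_polyLT
    ⟨⟨fun f x => B * f x, fun f g => ?_⟩, fun c f => ?_⟩ (fun k hk A => ?_) hf
  · ext1 x; simp [mul_add]
  · ext1 x; simp
  · simpa using pow_smul_mem_polyLT hk (B * A)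

theorem mul_const_mem_polyLT (B : Mat N) (hf : f ∈ polyLT N n) :
    (fun x => f x * B) ∈ polyLT N n := by
  refine map_mem_of_mem_polyLT
    ⟨⟨fun f x => f x * B, fun f g => ?_⟩, fun c f => ?_⟩ (fun k hk A => ?_) hf
  · ext1 x; simp [add_mul]
  · ext1 x; simp
  · simpa using pow_smul_mem_polyLT hk (A * B)

theorem id_smul_mem_polyLT (hf : f ∈ polyLT N n) :
    (fun x : ℤ => (x : ℂ) • f x) ∈ polyLT N (n + 1) := by
  refine map_mem_of_mem_polyLT
    ⟨⟨fun f x => (x : ℂ) • f x, fun f g => ?_⟩, fun c f => ?_⟩ (fun k hk A => ?_) hf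
  · ext1 x; simp
  · ext1 x; simp [smul_comm c]
  · simpa [smul_smul, pow_succ'] using pow_smul_mem_polyLT (Nat.succ_lt_succ hk) A

theorem exists_lead_of_mem_polyLT_succ (hf : f ∈ polyLT N (n + 1)) :
    ∃ A : Mat N, (fun x : ℤ => f x - (x : ℂ) ^ n • A) ∈ polyLT N n := by
  induction hf using Submodule.span_induction with
  | mem f h =>
    obtain ⟨k, hk, A, rfl⟩ := h
    rcases Nat.lt_succ_iff_lt_or_eq.1 hk with hk | rfl
    · exact ⟨0, by simpa using pow_smul_mem_polyLT hk A⟩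
    · exact ⟨A, by simpa using zero_mem_polyLT⟩
  | zero => exact ⟨0, by simpa using zero_mem_polyLT⟩
  | add f g _ _ hf hg =>
    obtain ⟨A, hA⟩ := hf
    obtain ⟨B, hB⟩ := hg
    refine ⟨A + B, ?_⟩
    convert (polyLT N n).add_mem hA hB using 1
    ext1 x
    simp only [Pi.add_apply, smul_add]
    abel
  | smul c f _ hf =>
    obtain ⟨A, hA⟩ := hf
    refine ⟨c • A, ?_⟩
    convert (polyLT N n).smul_mem c hA using 1
    ext1 x
    simp [smul_sub, smul_comm c]

theorem add_pow_sub_mem_polyLT (c : ℤ) (A : Mat N) :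
    (fun x : ℤ => ((x + c : ℤ) : ℂ) ^ (n + 1) • A - (x : ℂ) ^ (n + 1) • A
      - (x : ℂ) ^ n • ((c * (n + 1) : ℂ) • A)) ∈ polyLT N n := by
  have : (∑ i ∈ Finset.range n, fun x : ℤ =>
      (x : ℂ) ^ i • (((c : ℂ) ^ (n + 1 - i) * ((n + 1).choose i : ℂ)) • A)) ∈ polyLT N n :=
    Submodule.sum_mem _ fun i hi => pow_smul_mem_polyLT (Finset.mem_range.1 hi) _
  convert this using 1
  ext1 x
  simp only [Int.cast_add, add_pow, Finset.sum_range_succ, Finset.sum_apply, smul_smul,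
    ← Finset.sum_smul, ← sub_smul]
  congr 1
  simp [mul_assoc]

theorem shift_pow_sub_mem_polyLT (c : ℤ) (A : Mat N) :
    (fun x : ℤ => ((x + c : ℤ) : ℂ) ^ n • A - (x : ℂ) ^ n • A) ∈ polyLT N n := by
  rcases n with _ | n
  · simpa using zero_mem_polyLT
  · convert (polyLT N (n + 1)).add_mem
      (polyLT_mono n.le_succ (add_pow_sub_mem_polyLT c A))
      (pow_smul_mem_polyLT n.lt_succ_self ((c * (n + 1) : ℂ) • A)) using 1
    ext1 x
    simp

theorem shift_sub_mem_polyLT (c : ℤ) (hf : f ∈ polyLT N (n + 1)) :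
    (fun x => f (x + c) - f x) ∈ polyLT N n := by
  refine map_mem_of_mem_polyLT
    ⟨⟨fun f x => f (x + c) - f x, fun f g => ?_⟩, fun c f => ?_⟩ (fun k hk A => ?_) hf
  · ext1 x; simp only [Pi.add_apply]; abel
  · ext1 x; simp [smul_sub]
  · exact polyLT_mono (Nat.lt_succ_iff.1 hk) (shift_pow_sub_mem_polyLT c A)

theorem id_smul_shift_pow_sub_mem_polyLT (c : ℤ) (A : Mat N) :
    (fun x : ℤ => (x : ℂ) • (((x + c : ℤ) : ℂ) ^ n • A - (x : ℂ) ^ n • A)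
      - (x : ℂ) ^ n • ((c * n : ℂ) • A)) ∈ polyLT N n := by
  rcases n with _ | n
  · simpa using zero_mem_polyLT
  · convert id_smul_mem_polyLT (add_pow_sub_mem_polyLT (n := n) c A) using 1
    ext1 x
    simp only [smul_sub, smul_smul, pow_succ', Nat.cast_succ, mul_assoc]

/-- Multiplying a difference of `f` by the variable multiplies the leading coefficient by the
degree and the step. -/
theorem id_smul_shift_sub_mem_polyLT (c : ℤ) {A : Mat N}
    (hf : (fun x : ℤ => f x - (x : ℂ) ^ n • A) ∈ polyLT N n) :
    (fun x : ℤ => (x : ℂ) • (f (x + c) - f x) - (x : ℂ) ^ n • ((c * n : ℂ) • A))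
      ∈ polyLT N n := by
  have key : (fun x : ℤ => (x : ℂ) • ((f (x + c) - ((x + c : ℤ) : ℂ) ^ n • A)
      - (f x - (x : ℂ) ^ n • A))) ∈ polyLT N n := by
    rcases n with _ | n
    · have h0 : ∀ x, f x = A := by
        have : polyLT N 0 = ⊥ := by simp [polyLT]
        rw [this, Submodule.mem_bot] at hf
        intro x
        simpa [sub_eq_zero] using congrFun hf x
      simpa [h0] using zero_mem_polyLT
    · exact id_smul_mem_polyLT (shift_sub_mem_polyLT c hf)
  convert (polyLT N n).add_mem key (id_smul_shift_pow_sub_mem_polyLT c A) using 1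
  ext1 x
  simp only [Pi.add_apply, smul_sub]
  abel

theorem mem_polyLT_succ_of_lead {A : Mat N}
    (hf : (fun x : ℤ => f x - (x : ℂ) ^ n • A) ∈ polyLT N n) : f ∈ polyLT N (n + 1) := by
  convert (polyLT N (n + 1)).add_mem (polyLT_mono n.le_succ hf)
    (pow_smul_mem_polyLT n.lt_succ_self A) using 1
  ext1 x
  simp

end polyLT

theorem matEval_sub_pow_mem_polyLT {N n : ℕ} {P : Polynomial (Mat N)} (hm : P.Monic)
    (hd : P.natDegree = n) :
    (fun x : ℤ => matEval P (x : ℂ) - (x : ℂ) ^ n • (1 : Mat N)) ∈ polyLT N n := by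
  have : (∑ i ∈ Finset.range n, fun x : ℤ => (x : ℂ) ^ i • P.coeff i) ∈ polyLT N n :=
    Submodule.sum_mem _ fun i hi => pow_smul_mem_polyLT (Finset.mem_range.1 hi) _
  convert this using 1
  ext1 x
  have hc : P.coeff n = 1 := hd ▸ hm
  simp [matEval, eval_eq_sum_range, hd, Finset.sum_range_succ, hc, _root_.smul_pow]

section weight

variable {N : ℕ} {W : ℤ → Mat N}

theorem IsWeight.isHermitian (hW : IsWeight W) (x : ℤ) : (W x)ᴴ = W x := by
  rcases lt_or_ge x 0 with hx | hx
  · simp [hW.neg x hx]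
  · lift x to ℕ using hx
    exact (hW.posDef x).isHermitian

theorem IsWeight.summable_pow_smul (hW : IsWeight W) (k : ℕ) :
    Summable fun x : ℕ => (x : ℂ) ^ k • W x := by
  refine Pi.summable.2 fun i => Pi.summable.2 fun j => Summable.of_norm ?_
  simpa using hW.moments k i j

theorem IsWeight.summable_inner_s5 (hW : IsWeight W) {m n : ℕ} {f g : ℤ → Mat N}
    (hf : f ∈ polyLT N m) (hg : g ∈ polyLT N n) :
    Summable fun x : ℕ => f x * W x * (g x)ᴴ := by
  induction hf using Submodule.span_induction with
  | mem f h =>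
    obtain ⟨k, -, A, rfl⟩ := h
    induction hg using Submodule.span_induction with
    | mem g h =>
      obtain ⟨l, -, B, rfl⟩ := h
      refine (((hW.summable_pow_smul (k + l)).mul_left A).mul_right Bᴴ).congr fun x => ?_
      simp [smul_smul, pow_add, mul_comm]
    | zero => simp
    | add f g _ _ hf hg => simpa [mul_add] using hf.add hg
    | smul c f _ hf => simpa using hf.const_smul (star c)
  | zero => simp
  | add f g _ _ hf hg => simpa [add_mul] using hf.add hg
  | smul c f _ hf => simpa using hf.const_smul c

theorem IsWeight.eq_zero_of_tsum_eq_zero (hW : IsWeight W) {n : ℕ} {f : ℤ → Mat N}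
    (hf : f ∈ polyLT N n) (h : ∑' x : ℕ, f x * W x * (f x)ᴴ = 0) (x : ℕ) : f x = 0 := by
  have hs := (hW.summable_inner_s5 hf hf).hasSum
  rw [h] at hs
  funext i
  have hi := Complex.hasSum_re (Pi.hasSum.1 (Pi.hasSum.1 hs i) i)
  have e : ∀ y : ℕ, (f y * W y * (f y)ᴴ) i i
      = star (star (f y i)) ⬝ᵥ (W y *ᵥ star (f y i)) := by
    intro y
    rw [dotProduct_mulVec, star_star]
    rfl
  simp only [e] at hi
  have hnn : ∀ y : ℕ, 0 ≤ (star (star (f y i)) ⬝ᵥ (W y *ᵥ star (f y i))).re := fun y =>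
    (hW.posDef y).posSemidef.re_dotProduct_nonneg _
  have hz := congrFun ((hasSum_zero_iff_of_nonneg hnn).1 hi) x
  by_contra hne
  exact absurd hz ((hW.posDef x).re_dotProduct_pos (star_ne_zero.2 hne)).ne'

/-- Summation by parts against a weight. -/
theorem IsWeight.tsum_nabla_mul (hW : IsWeight W) {m n : ℕ} {f g : ℤ → Mat N}
    (hf : f ∈ polyLT N m) (hg : g ∈ polyLT N (n + 1)) :
    ∑' x : ℕ, nabla (fun y => f y * W y) x * (g x)ᴴ
      = -∑' x : ℕ, f x * W x * (g (x + 1) - g x)ᴴ := by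
  have hd := hW.summable_inner_s5 hf (shift_sub_mem_polyLT 1 hg)
  have h0 := hW.summable_inner_s5 hf hg
  have h1 : Summable fun x : ℕ => f x * W x * (g (x + 1))ᴴ := by
    simpa [mul_sub] using hd.add h0
  have h2 : Summable fun x : ℕ => f ((x : ℤ) - 1) * W ((x : ℤ) - 1) * (g x)ᴴ := by
    rw [← summable_nat_add_iff 1]
    simpa using h1
  simp only [nabla, sub_mul, conjTranspose_sub, mul_sub]
  rw [h0.tsum_sub h2, h1.tsum_sub h0, h2.tsum_eq_zero_add]
  simp [hW.neg (-1) (by norm_num)]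

theorem IsMOS.tsum_eq_zero (hW : IsWeight W) {P : ℕ → Polynomial (Mat N)} (hP : IsMOS W P)
    {n : ℕ} {g : ℤ → Mat N} (hg : g ∈ polyLT N n) :
    ∑' x : ℕ, matEval (P n) (x : ℤ) * W x * (g x)ᴴ = 0 := by
  have hlead := fun n => matEval_sub_pow_mem_polyLT (hP.monic n) (hP.deg n)
  have hPn := fun n => mem_polyLT_succ_of_lead (hlead n)
  suffices H : ∀ k ≤ n, ∀ g ∈ polyLT N k,
      ∑' x : ℕ, matEval (P n) (x : ℤ) * W x * (g x)ᴴ = 0 from H n le_rfl g hg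
  intro k
  induction k with
  | zero =>
    intro _ g hg
    have : g = 0 := by simpa [polyLT] using hg
    simp [this]
  | succ k ih =>
    intro hk g hg
    obtain ⟨A, hA⟩ := exists_lead_of_mem_polyLT_succ hg
    have hr : (fun x : ℤ => g x - A * matEval (P k) x) ∈ polyLT N k := by
      convert (polyLT N k).sub_mem hA (const_mul_mem_polyLT A (hlead k)) using 1
      ext1 x
      simp [mul_sub]
    have hAP := const_mul_mem_polyLT A (hPn k)
    have h1 := ih (by omega) _ hr
    have h2 : ∑' x : ℕ, matEval (P n) (x : ℤ) * W x * (A * matEval (P k) (x : ℤ))ᴴ = 0 := by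
      have ho := hP.orth n k (by omega)
      have hs := (hW.summable_inner_s5 (hPn n) (hPn k)).tsum_mul_right Aᴴ
      simp only [innerW] at ho
      simp only [conjTranspose_mul, ← mul_assoc]
      rw [hs]
      simp [ho]
    have h3 := (hW.summable_inner_s5 (hPn n) hr).tsum_add (hW.summable_inner_s5 (hPn n) hAP)
    rw [h1, h2, add_zero] at h3
    simpa [← mul_add, ← conjTranspose_add] using h3

end weight

theorem pearson_step {N : ℕ} {W W' : ℤ → Mat N} (hW : IsWeight W) (hW' : IsWeight W')
    {K2 K1 K0 J1 J0 : Mat N}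
    (h1 : ∀ x : ℤ, W' x = W x * ((x : ℂ) ^ 2 • K2 + (x : ℂ) • K1 + K0))
    (h2 : ∀ x : ℤ, W' x - W' (x - 1) = W x * ((x : ℂ) • J1 + J0))
    {P P' : ℕ → Polynomial (Mat N)} (hP : IsMOS W P) (hP' : IsMOS W' P') (n : ℕ) (x : ℤ) :
    (-((n : ℂ) • K2ᴴ) - J1ᴴ) * matEval (P (n + 1)) x * W x
      = -nabla (fun y => matEval (P' n) y * W' y) x := by
  have h1' : ∀ x : ℤ, W' x = ((x : ℂ) ^ 2 • K2ᴴ + (x : ℂ) • K1ᴴ + K0ᴴ) * W x := fun x => by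
    have := congrArg conjTranspose (h1 x)
    simpa [hW.isHermitian, hW'.isHermitian] using this
  have h2' : ∀ x : ℤ, W' x - W' (x - 1) = ((x : ℂ) • J1ᴴ + J0ᴴ) * W x := fun x => by
    have := congrArg conjTranspose (h2 x)
    simpa [hW.isHermitian, hW'.isHermitian] using this
  set Q : ℤ → Mat N := fun y => matEval (P' n) y with hQ
  set R : ℤ → Mat N := fun x =>
    (Q x - Q (x - 1)) * ((x : ℂ) ^ 2 • K2ᴴ + (x : ℂ) • K1ᴴ + K0ᴴ)
      + Q (x - 1) * ((x : ℂ) • J1ᴴ + J0ᴴ) with hR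
  have hRW : ∀ x, nabla (fun y => Q y * W' y) x = R x * W x := fun x => by
    simp only [hR]
    rw [add_mul, mul_assoc, mul_assoc, ← h1', ← h2']
    simp only [nabla]
    noncomm_ring
  set Gn : Mat N := -((n : ℂ) • K2ᴴ) - J1ᴴ with hG
  have hlP := matEval_sub_pow_mem_polyLT (hP.monic (n + 1)) (hP.deg (n + 1))
  have hlQ := matEval_sub_pow_mem_polyLT (hP'.monic n) (hP'.deg n)
  have hQm : Q ∈ polyLT N (n + 1) := mem_polyLT_succ_of_lead hlQ
  have hD := shift_sub_mem_polyLT (-1) hQm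
  have hxD := id_smul_shift_sub_mem_polyLT (-1) hlQ
  have hs : (fun x : ℤ => Q (x - 1) - (x : ℂ) ^ n • (1 : Mat N)) ∈ polyLT N n := by
    convert (polyLT N n).add_mem hD hlQ using 1
    ext1 x
    simp [hQ, ← sub_eq_add_neg]
  have hmono : ∀ {f : ℤ → Mat N}, f ∈ polyLT N n → f ∈ polyLT N (n + 1) :=
    fun h => polyLT_mono n.le_succ h
  have hp := fun A : Mat N => pow_smul_mem_polyLT n.lt_succ_self A
  set T : ℤ → Mat N := fun x => R x + Gn * matEval (P (n + 1)) x with hT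
  have hTm : T ∈ polyLT N (n + 1) := by
    have a1 := mul_const_mem_polyLT K2ᴴ (id_smul_mem_polyLT hxD)
    have a2 := mul_const_mem_polyLT K1ᴴ (hmono hxD)
    have a3 := mul_const_mem_polyLT K0ᴴ (hmono hD)
    have a4 := mul_const_mem_polyLT J1ᴴ (id_smul_mem_polyLT hs)
    have a5 := mul_const_mem_polyLT J0ᴴ (hmono hs)
    have a6 := const_mul_mem_polyLT Gn hlP
    have key := Submodule.add_mem _ (Submodule.add_mem _ (Submodule.sub_mem _ (Submodule.sub_mem _
      (Submodule.sub_mem _ (Submodule.add_mem _ a4 a5) a1) a2) a3) a6)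
      (Submodule.add_mem _ (hp ((n : ℂ) • K1ᴴ)) (hp J0ᴴ))
    convert key using 1
    ext1 x
    simp only [hT, hR, hG, Pi.add_apply, Pi.sub_apply, ← sub_eq_add_neg]
    have hPx : matEval (P' n) (x : ℂ) = Q x := rfl
    have hPx' : matEval (P' n) ((x - 1 : ℤ) : ℂ) = Q (x - 1) := rfl
    simp only [hPx, hPx']
    generalize Q x = q
    generalize Q (x - 1) = q'
    generalize matEval (P (n + 1)) (x : ℂ) = p
    simp only [mul_add, sub_mul, mul_sub, smul_sub, smul_mul_assoc,
      mul_smul_comm, one_mul, mul_one, smul_smul, neg_mul, Int.cast_neg, Int.cast_one, neg_smul,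
      smul_neg, pow_succ', pow_zero]
    module
  have horth : ∀ g ∈ polyLT N (n + 1), ∑' x : ℕ, T x * W x * (g x)ᴴ = 0 := by
    intro g hg
    have hGP := const_mul_mem_polyLT Gn (mem_polyLT_succ_of_lead hlP)
    have hRm : R ∈ polyLT N (n + 1 + 1) := by
      convert (polyLT N (n + 1 + 1)).sub_mem (polyLT_mono (n + 1).le_succ hTm) hGP using 1
      ext1 x
      simp [hT]
    have e1 : ∑' x : ℕ, R x * W x * (g x)ᴴ = 0 := by
      simp only [← hRW]
      rw [hW'.tsum_nabla_mul hQm hg, hP'.tsum_eq_zero hW' (shift_sub_mem_polyLT 1 hg), neg_zero]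
    have e2 : ∑' x : ℕ, Gn * matEval (P (n + 1)) (x : ℤ) * W x * (g x)ᴴ = 0 := by
      have hsum := hW.summable_inner_s5 (mem_polyLT_succ_of_lead hlP) hg
      have := hsum.tsum_mul_left Gn
      rw [hP.tsum_eq_zero hW hg, mul_zero] at this
      simpa only [mul_assoc] using this
    have e3 := (hW.summable_inner_s5 hRm hg).tsum_add (hW.summable_inner_s5 hGP hg)
    rw [e1, e2, add_zero] at e3
    simpa only [← add_mul] using e3
  have hTW : T x * W x = 0 := by
    rcases lt_or_ge x 0 with hx | hx
    · simp [hW.neg x hx]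
    · lift x to ℕ using hx
      simp [hW.eq_zero_of_tsum_eq_zero hTm (horth T hTm) x]
  rw [hRW, ← sub_eq_zero, sub_neg_eq_add, ← add_mul, add_comm]
  exact hTW

theorem nabla_const_mul {N : ℕ} (A : Mat N) (F : ℤ → Mat N) (x : ℤ) :
    nabla (fun y => A * F y) x = A * nabla F x :=
  (mul_sub A _ _).symm

theorem nabla_const_smul {N : ℕ} (c : ℂ) (F : ℤ → Mat N) (x : ℤ) :
    nabla (fun y => c • F y) x = c • nabla F x :=
  (smul_sub c _ _).symm

/-- the Rodrigues formula
`G_1^{(λ+n-1)} ⋯ G_n^{(λ)} · P_n^{(λ)}(x) · W^{(λ)}(x) = (-1)^n (W^{(λ+n)}·∇^n)(x)`. -/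
theorem rodrigues_formula {N : ℕ} (W : ℕ → ℤ → Mat N)
    (hW : ∀ lam, IsWeight (W lam))
    (K2 K1 K0 J1 J0 : ℕ → Mat N)
    (h1 : ∀ lam : ℕ, ∀ x : ℤ,
      W (lam + 1) x = W lam x * ((x : ℂ) ^ 2 • K2 lam + (x : ℂ) • K1 lam + K0 lam))
    (h2 : ∀ lam : ℕ, ∀ x : ℤ,
      W (lam + 1) x - W (lam + 1) (x - 1) = W lam x * ((x : ℂ) • J1 lam + J0 lam))
    (P : ℕ → ℕ → Polynomial (Mat N)) (hP : ∀ lam, IsMOS (W lam) (P lam))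
    (G : ℕ → ℕ → Mat N)
    (hG : ∀ n lam, G n lam = -(((n : ℂ) - 1) • (K2 lam)ᴴ) - (J1 lam)ᴴ) :
    ∀ n lam : ℕ, ∀ x : ℤ,
      ((List.range n).map fun i => G (i + 1) (lam + (n - 1 - i))).prod
          * matEval (P lam n) (x : ℂ) * W lam x
        = ((-1 : ℂ) ^ n) • (nabla^[n] (W (lam + n))) x := by
  intro n
  induction n with
  | zero =>
    intro lam x
    have h : P lam 0 = 1 :=
      ((hP lam).monic 0).natDegree_eq_zero.1 ((hP lam).deg 0)
    simp [h, matEval]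
  | succ n ih =>
    intro lam x
    have hprod : ((List.range n).map fun i => G (i + 1) (lam + (n + 1 - 1 - i)))
        = (List.range n).map fun i => G (i + 1) (lam + 1 + (n - 1 - i)) := by
      refine List.map_congr_left fun i hi => ?_
      have := List.mem_range.1 hi
      congr 1
      omega
    have hstep := pearson_step (hW lam) (hW (lam + 1)) (h1 lam) (h2 lam) (hP lam)
      (hP (lam + 1)) n x
    have hGn : G (n + 1) lam = -((n : ℂ) • (K2 lam)ᴴ) - (J1 lam)ᴴ := by simp [hG]
    rw [List.range_succ, List.map_append, List.prod_append, hprod]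
    simp only [List.map_cons, List.map_nil, List.prod_singleton, Nat.add_sub_cancel, Nat.sub_self,
      add_zero]
    rw [hGn, mul_assoc, mul_assoc, ← mul_assoc _ _ (W lam x), hstep, mul_neg, ← nabla_const_mul]
    simp only [← mul_assoc, ih (lam + 1)]
    rw [nabla_const_smul, Function.iterate_succ_apply', pow_succ, mul_neg_one, neg_smul,
      add_assoc, add_comm 1 n]
end
end

section
/- Let 𝒜, ℬ ∈ M_N(ℂ) be invertible and suppose that W(x) = 𝒜^x·(W(0)/x!)·ℬ^{−x} for x ∈ ℕ₀ (and W(x) = 0 for x < 0) is an N×N discrete matrix weight, with monic orthogonal sequence (P_n), squared norms H_n, and three term recurrence x·P_n(x) = P_{n+1}(x) + B_n P_n(x) + C_n P_{n−1}(x). Then the recurrence coefficients B_n are given by B_n = (ℬ^*)^{−1}H_n𝒜^*H_n^{−1} + H_n(𝒜^*)^{−1}H_{n−1}^{−1}ℬ^* for all n ≥ 1, and B_0 = (ℬ^*)^{−1}H_0𝒜^*H_0^{−1}. -/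
open scoped BigOperators ComplexOrder
open Matrix Polynomial Filter

noncomputable section

/-- `f` is a matrix polynomial function of degree at most `n` whose coefficient of degree `n`
is `c`. -/
def HasTopCoeff {N : ℕ} (n : ℕ) (f : ℂ → Mat N) (c : Mat N) : Prop :=
  ∀ i j, ∃ p : ℂ[X], p.natDegree ≤ n ∧ p.coeff n = c i j ∧ ∀ z, f z i j = p.eval z

namespace HasTopCoeff

variable {N n : ℕ} {f g : ℂ → Mat N} {c d : Mat N}

theorem sub (hf : HasTopCoeff n f c) (hg : HasTopCoeff n g d) :
    HasTopCoeff n (fun z => f z - g z) (c - d) := by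
  intro i j
  obtain ⟨p, hp, hpc, hpe⟩ := hf i j
  obtain ⟨q, hq, hqc, hqe⟩ := hg i j
  exact ⟨p - q, (natDegree_sub_le_of_le hp hq).trans (max_self n).le,
    by simp [hpc, hqc], fun z => by simp [hpe, hqe]⟩

theorem const_mul (hf : HasTopCoeff n f c) (M : Mat N) :
    HasTopCoeff n (fun z => M * f z) (M * c) := by
  intro i j
  choose p hp hpc hpe using hf
  refine ⟨∑ k, C (M i k) * p k j, natDegree_sum_le_of_forall_le _ _ fun k _ =>
    (natDegree_C_mul_le _ _).trans (hp k j), ?_, fun z => ?_⟩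
  · simp [finsetSum_coeff, hpc, Matrix.mul_apply]
  · simp [eval_finsetSum, hpe, Matrix.mul_apply]

theorem mul_const (hf : HasTopCoeff n f c) (M : Mat N) :
    HasTopCoeff n (fun z => f z * M) (c * M) := by
  intro i j
  choose p hp hpc hpe using hf
  refine ⟨∑ k, p i k * C (M k j), natDegree_sum_le_of_forall_le _ _ fun k _ =>
    (natDegree_mul_C_le _ _).trans (hp i k), ?_, fun z => ?_⟩
  · simp [finsetSum_coeff, hpc, Matrix.mul_apply]
  · simp [eval_finsetSum, hpe, Matrix.mul_apply]

theorem comp_add (hf : HasTopCoeff n f c) (r : ℂ) : HasTopCoeff n (fun z => f (z + r)) c := by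
  intro i j
  obtain ⟨p, hp, hpc, hpe⟩ := hf i j
  refine ⟨taylor r p, by rwa [natDegree_taylor], ?_, fun z => by simp [taylor_eval, hpe]⟩
  rcases hp.lt_or_eq with h | rfl
  · rw [← hpc, coeff_eq_zero_of_natDegree_lt h,
      coeff_eq_zero_of_natDegree_lt (by rwa [natDegree_taylor])]
  · rw [coeff_taylor_natDegree, ← hpc]; rfl

theorem comp_sub (hf : HasTopCoeff n f c) (r : ℂ) : HasTopCoeff n (fun z => f (z - r)) c := by
  simpa only [sub_eq_add_neg] using hf.comp_add (-r)

theorem smul_id (hf : HasTopCoeff n f c) : HasTopCoeff (n + 1) (fun z => z • f z) c := by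
  intro i j
  obtain ⟨p, hp, hpc, hpe⟩ := hf i j
  refine ⟨X * p, ?_, by simp [hpc], fun z => by simp [hpe]⟩
  exact natDegree_mul_le.trans (by have := natDegree_X_le (R := ℂ); omega)

theorem exists_pred (hf : HasTopCoeff (n + 1) f 0) : ∃ c, HasTopCoeff n f c := by
  choose p hp hpc hpe using hf
  refine ⟨Matrix.of fun i j => (p i j).coeff n, fun i j => ⟨p i j, ?_, rfl, hpe i j⟩⟩
  exact natDegree_le_iff_coeff_eq_zero.2 fun m hm => by
    rcases Nat.lt_or_ge (n + 1) m with h | h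
    · exact coeff_eq_zero_of_natDegree_lt ((hp i j).trans_lt h)
    · obtain rfl : m = n + 1 := by omega
      simpa using hpc i j

theorem eq_zero (hf : HasTopCoeff 0 f 0) : f = fun _ => 0 := by
  ext z i j
  obtain ⟨p, hp, hpc, hpe⟩ := hf i j
  rw [hpe, eq_C_of_natDegree_le_zero hp]
  simpa using hpc

/-- A monic polynomial function whose values on `ℕ` are all annihilated by a vector on the left
forces this vector to vanish. -/
theorem eq_zero_of_conjTranspose_mulVec (hf : HasTopCoeff n f 1) {v : Fin N → ℂ}
    (hv : ∀ x : ℕ, (f x)ᴴ *ᵥ v = 0) : v = 0 := by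
  ext j
  choose p hp hpc hpe using hf
  have hzero : ∑ i, C (star (v i)) * p i j = 0 := by
    refine eq_zero_of_infinite_isRoot _ ((Set.infinite_range_of_injective
      (Nat.cast_injective (R := ℂ))).mono ?_)
    rintro _ ⟨x, rfl⟩
    have := congrArg star (congrFun (hv x) j)
    simpa [IsRoot, eval_finsetSum, Matrix.mulVec, dotProduct, hpe, mul_comm] using this
  have := congrArg (fun q => q.coeff n) hzero
  simpa [finsetSum_coeff, hpc, Matrix.one_apply] using this

end HasTopCoeff

theorem hasTopCoeff_matEval {N n : ℕ} {P : Polynomial (Mat N)} (hP : P.natDegree ≤ n) :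
    HasTopCoeff n (matEval P) (P.coeff n) := by
  intro i j
  refine ⟨∑ k ∈ Finset.range (n + 1), monomial k (P.coeff k i j),
    natDegree_sum_le_of_forall_le _ _ fun k hk => (natDegree_monomial_le _).trans
      (by simpa [Nat.lt_succ_iff] using hk), ?_, fun z => ?_⟩
  · simp [finsetSum_coeff, coeff_monomial]
  · rw [matEval, eval_eq_sum_range' (Nat.lt_succ_of_le hP)]
    simp [eval_finsetSum, Matrix.sum_apply, _root_.smul_pow, mul_comm]

/-- The sesquilinear pairing `∑ₓ f(x) W(x) g(x)^*` of matrix-valued functions. -/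
def pairing {N : ℕ} (W : ℤ → Mat N) (f g : ℂ → Mat N) : Mat N :=
  ∑' x : ℕ, f x * W x * (g x)ᴴ

section Pairing

variable {N m n : ℕ} {W : ℤ → Mat N} {f g h : ℂ → Mat N} {b c d : Mat N}

theorem IsWeight.summable_eval_mul (hW : IsWeight W) (p : ℂ[X]) (i j : Fin N) :
    Summable fun x : ℕ => p.eval (x : ℂ) * W x i j := by
  induction p using Polynomial.induction_on' with
  | add p q hp hq => simpa [add_mul] using hp.add hq
  | monomial k a =>
    have : Summable fun x : ℕ => (x : ℂ) ^ k * W x i j :=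
      .of_norm (by simpa using hW.moments k i j)
    simpa [mul_assoc] using this.mul_left a

theorem IsWeight.summable_pairing (hW : IsWeight W) (hf : HasTopCoeff m f c)
    (hg : HasTopCoeff n g d) : Summable fun x : ℕ => f x * W x * (g x)ᴴ := by
  refine Pi.summable.2 fun i => Pi.summable.2 fun j => ?_
  choose p _ _ hp using hf
  choose q _ _ hq using hg
  have hconj (l : Fin N) (x : ℕ) :
      star ((q j l).eval (x : ℂ)) = ((q j l).map (starRingEnd ℂ)).eval (x : ℂ) := by
    simp
  have : Summable fun x : ℕ => ∑ l, ∑ k,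
      (p i k * (q j l).map (starRingEnd ℂ)).eval (x : ℂ) * W x k l :=
    summable_sum fun l _ => summable_sum fun k _ => hW.summable_eval_mul _ k l
  refine this.congr fun x => ?_
  simp only [Matrix.mul_apply, Matrix.conjTranspose_apply, hp, hq, hconj, eval_mul,
    Finset.sum_mul]
  exact Finset.sum_congr rfl fun l _ => Finset.sum_congr rfl fun k _ => by ring

theorem IsWeight.pairing_sub_right (hW : IsWeight W) (hf : HasTopCoeff m f b)
    (hg : HasTopCoeff n g c) {k : ℕ} (hh : HasTopCoeff k h d) :
    pairing W f (fun z => g z - h z) = pairing W f g - pairing W f h := by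
  simp only [pairing, Matrix.conjTranspose_sub, mul_sub]
  exact (hW.summable_pairing hf hg).tsum_sub (hW.summable_pairing hf hh)

theorem IsWeight.pairing_const_mul_right (hW : IsWeight W) (hf : HasTopCoeff m f b)
    (hg : HasTopCoeff n g c) (M : Mat N) :
    pairing W f (fun z => M * g z) = pairing W f g * Mᴴ := by
  simp only [pairing, Matrix.conjTranspose_mul, ← mul_assoc]
  exact (hW.summable_pairing hf hg).tsum_mul_right _

theorem IsWeight.conjTranspose_pairing (hW : IsWeight W) (f g : ℂ → Mat N) :
    (pairing W f g)ᴴ = pairing W g f := by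
  simp only [pairing, Matrix.conjTranspose_tsum, Matrix.conjTranspose_mul,
    Matrix.conjTranspose_conjTranspose, (hW.posDef _).isHermitian.eq, mul_assoc]

/-- If `f` is a monic polynomial function, then `⟨f, f⟩` is invertible. -/
theorem IsWeight.isUnit_pairing_self (hW : IsWeight W) (hf : HasTopCoeff n f 1) :
    IsUnit (pairing W f f) := by
  rw [Matrix.isUnit_iff_isUnit_det, isUnit_iff_ne_zero]
  intro hdet
  obtain ⟨v, hv, hv0⟩ := Matrix.exists_mulVec_eq_zero_iff.2 hdet
  refine hv (hf.eq_zero_of_conjTranspose_mulVec fun x => ?_)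
  let φ : Mat N →+ ℝ :=
    { toFun M := (star v ⬝ᵥ M *ᵥ v).re
      map_zero' := by simp
      map_add' := by simp [Matrix.add_mulVec] }
  have hφ : Continuous φ := by
    change Continuous fun M : Mat N => (star v ⬝ᵥ M *ᵥ v).re
    fun_prop
  have hsum : HasSum (fun x : ℕ => φ (f x * W x * (f x)ᴴ)) 0 := by
    have := (hW.summable_pairing hf hf).hasSum.map φ hφ
    rw [show ∑' x : ℕ, f x * W x * (f x)ᴴ = pairing W f f from rfl] at this
    simpa [φ, hv0, Function.comp_def] using this
  have hform (x : ℕ) : φ (f x * W x * (f x)ᴴ)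
      = (star ((f x)ᴴ *ᵥ v) ⬝ᵥ W x *ᵥ ((f x)ᴴ *ᵥ v)).re := by
    simp [φ, Matrix.star_mulVec, Matrix.dotProduct_mulVec, Matrix.vecMul_vecMul, mul_assoc]
  have hnonneg (x : ℕ) : 0 ≤ φ (f x * W x * (f x)ᴴ) := by
    rw [hform]
    exact (Complex.le_def.1 ((hW.posDef x).posSemidef.dotProduct_mulVec_nonneg _)).1
  have hx := congrFun ((hasSum_zero_iff_of_nonneg hnonneg).1 hsum) x
  by_contra hne
  have hpos := (Complex.lt_def.1 ((hW.posDef x).dotProduct_mulVec_pos hne)).1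
  rw [hform] at hx
  exact hpos.ne' hx

/-- Adjoint of the operator `f(x) ↦ f(x+1) M` for the pairing, for `M` intertwining consecutive
values of the weight. -/
theorem IsWeight.pairing_shift (hW : IsWeight W) {M M' : Mat N}
    (hM : ∀ x : ℕ, M * W x = ((x : ℂ) + 1) • (W ((x + 1 : ℕ) : ℤ) * M'))
    (hf : HasTopCoeff m f c) (hg : HasTopCoeff n g d) :
    pairing W (fun z => f (z + 1) * M) g = pairing W f fun z => z • (g (z - 1) * M'ᴴ) := by
  have hsum := hW.summable_pairing hf ((hg.comp_sub 1).mul_const M'ᴴ).smul_id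
  rw [pairing, pairing, hsum.tsum_eq_zero_add]
  simp only [Nat.cast_zero, zero_smul, Matrix.conjTranspose_zero, mul_zero, zero_add]
  refine tsum_congr fun x => ?_
  rw [mul_assoc (f _), hM]
  simp [Matrix.conjTranspose_smul, mul_assoc]

/-- Orthogonality of a monic sequence of polynomial functions determines its pairings with
polynomial functions of lower degree. -/
theorem IsWeight.pairing_eq_zero (hW : IsWeight W) {p : ℕ → ℂ → Mat N}
    (hp : ∀ n, HasTopCoeff n (p n) 1) (horth : ∀ m n, m ≠ n → pairing W (p m) (p n) = 0)
    (hf : HasTopCoeff m f c) (hmn : m < n) : pairing W (p n) f = 0 := by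
  induction m generalizing f c with
  | zero =>
    have hr := hf.sub ((hp 0).const_mul c)
    have h1 := hW.pairing_sub_right (hp n) hf ((hp 0).const_mul c)
    rw [mul_one, sub_self] at hr
    rw [hr.eq_zero, hW.pairing_const_mul_right (hp n) (hp 0), horth n 0 (by omega)] at h1
    simpa [pairing] using h1.symm
  | succ m ih =>
    have hr := hf.sub ((hp (m + 1)).const_mul c)
    have h1 := hW.pairing_sub_right (hp n) hf ((hp (m + 1)).const_mul c)
    rw [mul_one, sub_self] at hr
    obtain ⟨d, hd⟩ := hr.exists_pred
    rw [ih hd (by omega), hW.pairing_const_mul_right (hp n) (hp (m + 1)),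
      horth n (m + 1) (by omega)] at h1
    simpa using h1.symm

theorem IsWeight.pairing_eq_mul_conjTranspose (hW : IsWeight W) {p : ℕ → ℂ → Mat N}
    (hp : ∀ n, HasTopCoeff n (p n) 1) (horth : ∀ m n, m ≠ n → pairing W (p m) (p n) = 0)
    (hf : HasTopCoeff n f c) : pairing W (p n) f = pairing W (p n) (p n) * cᴴ := by
  have hr := hf.sub ((hp n).const_mul c)
  have h1 := hW.pairing_sub_right (hp n) hf ((hp n).const_mul c)
  rw [mul_one, sub_self] at hr
  rw [hW.pairing_const_mul_right (hp n) (hp n)] at h1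
  suffices h0 : pairing W (p n) (fun z => f z - c * p n z) = 0 from
    sub_eq_zero.1 (h1.symm.trans h0)
  cases n with
  | zero => rw [hr.eq_zero]; simp [pairing]
  | succ n =>
    obtain ⟨d, hd⟩ := hr.exists_pred
    exact hW.pairing_eq_zero hp horth hd n.lt_succ_self

end Pairing

/-- the three term recurrence coefficients `B_n` for the weight
`W(x) = 𝒜^x (W(0)/x!) ℬ^{-x}` in terms of the squared norms. -/
theorem recurrence_coefficient_Bn {N : ℕ} (A Bmat W0 : Mat N)
    (hA : IsUnit A) (hB : IsUnit Bmat)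
    (W : ℤ → Mat N) (hW : IsWeight W)
    (hform : ∀ x : ℕ, W (x : ℤ)
      = ((x.factorial : ℂ))⁻¹ • (A ^ x * W0 * (Bmat⁻¹) ^ x))
    (hW00 : W0 = W 0)
    (P : ℕ → Polynomial (Mat N)) (hP : IsMOS W P)
    (H : ℕ → Mat N) (hH : ∀ n, H n = innerW W (P n) (P n))
    (B C : ℕ → Mat N)
    (hrec : ∀ n : ℕ, ∀ z : ℂ, z • matEval (P n) z
      = matEval (P (n + 1)) z + B n * matEval (P n) z
          + (if n = 0 then 0 else C n * matEval (P (n - 1)) z)) :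
    (∀ n : ℕ, 1 ≤ n →
      B n = (Bmatᴴ)⁻¹ * H n * Aᴴ * (H n)⁻¹
          + H n * (Aᴴ)⁻¹ * (H (n - 1))⁻¹ * Bmatᴴ) ∧
    B 0 = (Bmatᴴ)⁻¹ * H 0 * Aᴴ * (H 0)⁻¹ := by
  have hp (n : ℕ) : HasTopCoeff n (matEval (P n)) 1 := by
    have h1 : (P n).coeff n = 1 := by
      have := (hP.monic n).coeff_natDegree
      rwa [hP.deg n] at this
    exact h1 ▸ hasTopCoeff_matEval (hP.deg n).le
  have hH' (n : ℕ) : H n = pairing W (matEval (P n)) (matEval (P n)) := hH n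
  have horth : ∀ m n, m ≠ n → pairing W (matEval (P m)) (matEval (P n)) = 0 := hP.orth
  have hHu (n : ℕ) : IsUnit (H n).det :=
    (Matrix.isUnit_iff_isUnit_det _).1 (hH' n ▸ hW.isUnit_pairing_self (hp n))
  have hHs (n : ℕ) : (H n)ᴴ = H n := by rw [hH', hW.conjTranspose_pairing]
  rw [Matrix.isUnit_iff_isUnit_det] at hA hB
  have hA' : IsUnit (Aᴴ).det := by rw [Matrix.det_conjTranspose]; exact hA.star
  have hB' : IsUnit (Bmatᴴ).det := by rw [Matrix.det_conjTranspose]; exact hB.star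
  have hstep (x : ℕ) : A * W x = ((x : ℂ) + 1) • (W ((x + 1 : ℕ) : ℤ) * Bmat) := by
    have hx : (x : ℂ) + 1 ≠ 0 := by exact_mod_cast x.succ_ne_zero
    rw [hform, hform, Nat.factorial_succ, pow_succ' A, pow_succ Bmat⁻¹]
    simp only [smul_mul_assoc, mul_smul_comm, smul_smul, mul_assoc,
      Matrix.nonsing_inv_mul _ hB, mul_one]
    push_cast
    rw [mul_inv, mul_inv_cancel_left₀ hx]
  have hstep' (x : ℕ) : (Bmatᴴ)⁻¹ * W x
      = ((x : ℂ) + 1) • (W ((x + 1 : ℕ) : ℤ) * (Aᴴ)⁻¹) := by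
    have h1 := congrArg Matrix.conjTranspose (hstep x)
    rw [Matrix.conjTranspose_smul, Matrix.conjTranspose_mul, Matrix.conjTranspose_mul,
      (hW.posDef _).isHermitian.eq, (hW.posDef _).isHermitian.eq] at h1
    rw [← Matrix.mul_nonsing_inv_cancel_right (A := Aᴴ) ((Bmatᴴ)⁻¹ * W x) hA', mul_assoc _ _ Aᴴ,
      h1]
    simp [← mul_assoc, Matrix.nonsing_inv_mul _ hB']
  have hE {m n : ℕ} {f g : ℂ → Mat N} {c d : Mat N} (hf : HasTopCoeff m f c)
      (hg : HasTopCoeff n g d) : pairing W (fun z => f (z + 1) * A) g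
        = pairing W f fun z => z • (g (z - 1) * Bmatᴴ) :=
    hW.pairing_shift hstep hf hg
  have hD {m n : ℕ} {f g : ℂ → Mat N} {c d : Mat N} (hf : HasTopCoeff m f c)
      (hg : HasTopCoeff n g d) : pairing W (fun z => f (z + 1) * (Bmatᴴ)⁻¹) g
        = pairing W f fun z => z • (g (z - 1) * A⁻¹) := by
    have hAA : ((Aᴴ)⁻¹)ᴴ = A⁻¹ := by
      rw [Matrix.conjTranspose_nonsing_inv, Matrix.conjTranspose_conjTranspose]
    rw [← hAA]
    exact hW.pairing_shift hstep' hf hg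
  have hBH (n : ℕ) : H n * (B n)ᴴ = pairing W (matEval (P n)) fun z => z • matEval (P n) z := by
    have hs := (hp n).smul_id
    have h1 := hs.sub (hp (n + 1))
    rw [sub_self] at h1
    obtain ⟨d, hd⟩ := h1.exists_pred
    have h2 := hd.sub ((hp n).const_mul (B n))
    have h3 : pairing W (matEval (P n)) (fun z => z • matEval (P n) z - matEval (P (n + 1)) z
        - B n * matEval (P n) z) = 0 := by
      simp only [hrec n]
      rcases n with _ | n
      · simp [pairing]
      · simp only [add_sub_cancel_left, add_sub_right_comm, Nat.succ_ne_zero,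
          if_false, Nat.add_sub_cancel]
        rw [hW.pairing_const_mul_right (hp (n + 1)) (hp n), horth _ _ (by omega), zero_mul]
    rw [hW.pairing_sub_right (hp n) hd ((hp n).const_mul _),
      hW.pairing_sub_right (hp n) hs (hp (n + 1)), horth n (n + 1) (by omega), sub_zero,
      hW.pairing_const_mul_right (hp n) (hp n), ← hH', sub_eq_zero] at h3
    exact h3.symm
  have hBH' (n : ℕ) : B n * H n = pairing W (fun z => matEval (P n) (z + 1) * (Bmatᴴ)⁻¹)
      fun z => matEval (P n) (z + 1) * A := by
    rw [hD (hp n) (((hp n).comp_add 1).mul_const A), ← hHs n,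
      ← Matrix.conjTranspose_conjTranspose (B n), ← Matrix.conjTranspose_mul, hBH,
      hW.conjTranspose_pairing]
    simp only [sub_add_cancel, mul_assoc, Matrix.mul_nonsing_inv _ hA, mul_one]
    simp [pairing, Matrix.conjTranspose_smul]
  have hDp (n : ℕ) : HasTopCoeff n (fun z => matEval (P n) (z + 1) * (Bmatᴴ)⁻¹) (Bmatᴴ)⁻¹ := by
    simpa using ((hp n).comp_add 1).mul_const (Bmatᴴ)⁻¹
  have hEp (n : ℕ) : HasTopCoeff n (fun z => matEval (P n) (z + 1) * A) A := by
    simpa using ((hp n).comp_add 1).mul_const A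
  have hlow (n : ℕ) : HasTopCoeff n
      (fun z => matEval (P n) (z + 1) * A - A * matEval (P n) z) 0 := by
    simpa using (hEp n).sub ((hp n).const_mul A)
  have hmain (n : ℕ) : B n * H n = (Bmatᴴ)⁻¹ * H n * Aᴴ
      + pairing W (fun z => matEval (P n) (z + 1) * (Bmatᴴ)⁻¹)
        (fun z => matEval (P n) (z + 1) * A - A * matEval (P n) z) := by
    have h1 : pairing W (fun z => matEval (P n) (z + 1) * (Bmatᴴ)⁻¹) (matEval (P n))
        = (Bmatᴴ)⁻¹ * H n := by
      rw [← hW.conjTranspose_pairing, hW.pairing_eq_mul_conjTranspose hp horth (hDp n), ← hH',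
        Matrix.conjTranspose_mul, hHs, Matrix.conjTranspose_conjTranspose]
    rw [hW.pairing_sub_right (hDp n) (hEp n) ((hp n).const_mul A),
      hW.pairing_const_mul_right (hDp n) (hp n), h1, ← hBH']
    abel
  constructor
  · intro n hn
    obtain ⟨n, rfl⟩ := Nat.exists_eq_add_of_le' hn
    obtain ⟨c, hc⟩ := (hlow (n + 1)).exists_pred
    have h1 := hmain (n + 1)
    have hcA := ((hc.comp_sub 1).mul_const A⁻¹).smul_id
    have h2 := hW.pairing_eq_mul_conjTranspose hp horth hcA
    rw [hD (hp (n + 1)) hc, h2, ← hH'] at h1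
    have hcH : H n * cᴴ = Bmatᴴ * H (n + 1) := by
      have hpB := ((hp n).comp_sub 1).mul_const Bmatᴴ
      have h3 := hW.pairing_eq_mul_conjTranspose hp horth hpB.smul_id
      rw [one_mul, Matrix.conjTranspose_conjTranspose, ← hE (hp (n + 1)) (hp n), ← hH'] at h3
      rw [hH' n, ← hW.pairing_eq_mul_conjTranspose hp horth hc,
        hW.pairing_sub_right (hp n) (hEp (n + 1)) ((hp (n + 1)).const_mul A),
        hW.pairing_const_mul_right (hp n) (hp (n + 1)), horth n (n + 1) (by omega), zero_mul,
        sub_zero, ← hW.conjTranspose_pairing, h3, Matrix.conjTranspose_mul, hHs]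
    have hc' : cᴴ = (H n)⁻¹ * (Bmatᴴ * H (n + 1)) := by
      rw [← hcH, Matrix.nonsing_inv_mul_cancel_left _ _ (hHu n)]
    rw [← Matrix.mul_nonsing_inv_cancel_right _ (B (n + 1)) (hHu (n + 1)), h1,
      Matrix.conjTranspose_mul, hc', Matrix.conjTranspose_nonsing_inv, add_mul]
    simp only [← mul_assoc, Nat.add_sub_cancel]
    rw [Matrix.mul_nonsing_inv_cancel_right _ _ (hHu (n + 1))]
  · have h0 : B 0 * H 0 = (Bmatᴴ)⁻¹ * H 0 * Aᴴ := by
      rw [hmain 0, (hlow 0).eq_zero]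
      simp [pairing]
    rw [← h0, Matrix.mul_nonsing_inv_cancel_right _ _ (hHu 0)]
end
end

section
/- In the matrix Charlier setting with general parameters, for every λ ∈ ℕ₀ the zeroth moment of the weight admits the LDU factorization ∑_{x=0}^∞ W^{(λ)}(x) = L_0^{−1}·(I+A)^λ·D_0^{(λ)}·(I+A^*)^λ·(L_0^*)^{−1}, with the series converging entrywise absolutely, where D_0^{(λ)} is the diagonal matrix with entries (D_0^{(λ)})_{jj} = μ_j²·a^j·e^a·∑_{ℓ=1}^j (δ_ℓ^{(λ)}/μ_ℓ²)·a^{−ℓ}/(j−ℓ)!. -/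
open scoped BigOperators ComplexOrder
open Matrix Polynomial

noncomputable section

/-- The scalar Charlier polynomial
`c_n^{(a)}(x) = ∑_{k=0}^n ((-n)_k (-x)_k / k!) (-1/a)^k`. -/
def charlier (a : ℂ) (n : ℕ) (x : ℂ) : ℂ :=
  ∑ k ∈ Finset.range (n + 1),
    (ascPochhammer ℂ k).eval (-(n : ℂ)) * (ascPochhammer ℂ k).eval (-x)
      / (k.factorial : ℂ) * (-(1 / a)) ^ k

/-- The nilpotent matrix `A` with `A_{j+1,j} = μ_{j+1}/μ_j` (paper indices `1,…,N`). -/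
def Amat (N : ℕ) (μ : ℕ → ℝ) : Mat N :=
  Matrix.of fun j k : Fin N =>
    if (j : ℕ) = (k : ℕ) + 1 then ((μ ((j : ℕ) + 1) / μ ((k : ℕ) + 1) : ℝ) : ℂ) else 0

/-- The diagonal matrix `T = diag(δ_1,…,δ_N)`. -/
def Tmat (N : ℕ) (δ : ℕ → ℝ) : Mat N :=
  Matrix.diagonal fun k : Fin N => ((δ ((k : ℕ) + 1) : ℝ) : ℂ)

/-- The matrix Charlier weight
`W^{(λ)}(x) = (a^x/x!) (I+A)^{x+λ} T^{(λ)} (I+A^*)^{x+λ}`. -/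
def Wch (N : ℕ) (a : ℝ) (μ δ : ℕ → ℝ) (lam x : ℕ) : Mat N :=
  ((a ^ x / x.factorial : ℝ) : ℂ) •
    ((1 + Amat N μ) ^ (x + lam) * Tmat N δ * (1 + (Amat N μ)ᴴ) ^ (x + lam))

/-- The unipotent lower triangular matrix `L(x)` with entries
`L(x)_{j,k} = (μ_j/μ_k)(-a)^{j-k} c_{j-k}^{(a)}(x)/(j-k)!` for `j ≥ k`. -/
def Lmat (N : ℕ) (a : ℝ) (μ : ℕ → ℝ) (z : ℂ) : Mat N :=
  Matrix.of fun j k : Fin N =>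
    if (k : ℕ) ≤ (j : ℕ) then
      ((μ ((j : ℕ) + 1) / μ ((k : ℕ) + 1) : ℝ) : ℂ) * (-(a : ℂ)) ^ ((j : ℕ) - (k : ℕ))
        * charlier (a : ℂ) ((j : ℕ) - (k : ℕ)) z / ((((j : ℕ) - (k : ℕ)).factorial) : ℂ)
    else 0

/-- Matrix-valued inner product for a weight supported on `ℕ₀`. -/
def innerN {N : ℕ} (W : ℕ → Mat N) (P Q : Polynomial (Mat N)) : Mat N :=
  ∑' x : ℕ, matEval P x * W x * (matEval Q x)ᴴ

/-- `P` is the monic orthogonal sequence of the weight `W` supported on `ℕ₀`. -/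
structure IsMOSN {N : ℕ} (W : ℕ → Mat N) (P : ℕ → Polynomial (Mat N)) : Prop where
  monic : ∀ n, (P n).Monic
  deg : ∀ n, (P n).natDegree = n
  orth : ∀ m n, m ≠ n → innerN W (P m) (P n) = 0

/-- The diagonal matrix `J = diag(1,2,…,N)`. -/
def Jdiag (N : ℕ) : Mat N := Matrix.diagonal fun j : Fin N => ((j : ℕ) + 1 : ℂ)

/-- The lower triangular Toeplitz matrix of a real power series, conjugated by `diag(μ_1,…,μ_N)`. -/
def toeplitz (N : ℕ) (μ : ℕ → ℝ) (f : PowerSeries ℝ) : Mat N :=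
  Matrix.of fun j k : Fin N =>
    if (k : ℕ) ≤ (j : ℕ) then
      ((μ ((j : ℕ) + 1) / μ ((k : ℕ) + 1) * PowerSeries.coeff ((j : ℕ) - (k : ℕ)) f : ℝ) : ℂ)
    else 0

theorem toeplitz_apply_eq_zero {N : ℕ} {μ : ℕ → ℝ} {f : PowerSeries ℝ} {j k : Fin N}
    (h : ¬ (k : ℕ) ≤ j) : toeplitz N μ f j k = 0 :=
  if_neg h

theorem toeplitz_one {N : ℕ} {μ : ℕ → ℝ} (hμ : ∀ j : ℕ, 1 ≤ j → j ≤ N → 0 < μ j) :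
    toeplitz N μ 1 = 1 := by
  ext j k
  have hk := (hμ (k + 1) (by omega) (by omega)).ne'
  by_cases h : j = k
  · subst h
    simp [toeplitz, hk]
  · have hjk : (j : ℕ) ≠ k := fun h' => h (Fin.ext h')
    rw [Matrix.one_apply_ne h]
    simp only [toeplitz, Matrix.of_apply, PowerSeries.coeff_one]
    split_ifs <;> first | omega | simp

theorem toeplitz_add (N : ℕ) (μ : ℕ → ℝ) (f g : PowerSeries ℝ) :
    toeplitz N μ (f + g) = toeplitz N μ f + toeplitz N μ g := by
  ext j k
  simp only [toeplitz, Matrix.of_apply, Matrix.add_apply, map_add]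
  split_ifs
  · push_cast; ring
  · simp

theorem toeplitz_mul {N : ℕ} {μ : ℕ → ℝ} (hμ : ∀ j : ℕ, 1 ≤ j → j ≤ N → 0 < μ j)
    (f g : PowerSeries ℝ) : toeplitz N μ (f * g) = toeplitz N μ f * toeplitz N μ g := by
  ext j k
  let F : ℕ → ℂ := fun l => if l ∈ Finset.Icc (k : ℕ) j then
    ((μ (j + 1) / μ (k + 1) * (PowerSeries.coeff (j - l) f * PowerSeries.coeff (l - k) g) : ℝ)
      : ℂ) else 0
  have hterm : ∀ l : Fin N, toeplitz N μ f j l * toeplitz N μ g l k = F l := by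
    intro l
    have hl := (hμ (l + 1) (by omega) (by omega)).ne'
    simp only [F, toeplitz, Matrix.of_apply, Finset.mem_Icc]
    by_cases h₁ : (l : ℕ) ≤ j <;> by_cases h₂ : (k : ℕ) ≤ l <;> simp only [h₁, h₂, and_self,
      and_true, and_false, if_true, if_false, mul_zero, zero_mul]
    rw [← Complex.ofReal_mul]
    congr 1
    field_simp
  rw [Matrix.mul_apply, Finset.sum_congr rfl fun l _ => hterm l, Fin.sum_univ_eq_sum_range F,
    Finset.sum_ite_mem, Finset.inter_eq_right.2 (fun l hl => by
      simp only [Finset.mem_Icc, Finset.mem_range] at *; omega)]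
  simp only [toeplitz, Matrix.of_apply]
  split_ifs with h
  · rw [← Complex.ofReal_sum, ← Finset.mul_sum, PowerSeries.coeff_mul]
    congr 2
    refine Finset.sum_nbij' (fun p => k + p.2) (fun l => (j - l, l - k)) ?_ ?_ ?_ ?_ ?_
    · intro p hp
      simp only [Finset.HasAntidiagonal.mem_antidiagonal, Finset.mem_Icc] at *
      omega
    · intro l hl
      simp only [Finset.HasAntidiagonal.mem_antidiagonal, Finset.mem_Icc] at *
      omega
    · intro p hp
      simp only [Finset.HasAntidiagonal.mem_antidiagonal] at hp
      ext <;> simp only <;> omega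
    · intro l hl
      simp only [Finset.mem_Icc] at hl
      simp only
      omega
    · intro p hp
      simp only [Finset.HasAntidiagonal.mem_antidiagonal] at hp
      congr 3 <;> omega
  · rw [Finset.Icc_eq_empty (by omega), Finset.sum_empty]

theorem toeplitz_pow {N : ℕ} {μ : ℕ → ℝ} (hμ : ∀ j : ℕ, 1 ≤ j → j ≤ N → 0 < μ j)
    (f : PowerSeries ℝ) (n : ℕ) : toeplitz N μ (f ^ n) = toeplitz N μ f ^ n := by
  induction n with
  | zero => rw [pow_zero, pow_zero, toeplitz_one hμ]
  | succ n ih => rw [pow_succ, pow_succ, toeplitz_mul hμ, ih]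

theorem Amat_eq_toeplitz (N : ℕ) (μ : ℕ → ℝ) : Amat N μ = toeplitz N μ PowerSeries.X := by
  ext j k
  simp only [Amat, toeplitz, Matrix.of_apply, PowerSeries.coeff_X]
  split_ifs <;> first | omega | simp

theorem one_add_Amat_eq_toeplitz {N : ℕ} {μ : ℕ → ℝ}
    (hμ : ∀ j : ℕ, 1 ≤ j → j ≤ N → 0 < μ j) :
    1 + Amat N μ = toeplitz N μ (1 + PowerSeries.X) := by
  rw [toeplitz_add, toeplitz_one hμ, Amat_eq_toeplitz]

theorem charlier_zero_right (a : ℂ) (n : ℕ) : charlier a n 0 = 1 := by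
  rw [charlier, Finset.sum_range_succ']
  simp

/-- The power series `exp(-a X)`. -/
def expNeg (a : ℝ) : PowerSeries ℝ := PowerSeries.rescale (-a) (PowerSeries.exp ℝ)

theorem coeff_expNeg (a : ℝ) (n : ℕ) :
    PowerSeries.coeff n (expNeg a) = (-a) ^ n / n.factorial := by
  simp [expNeg, PowerSeries.coeff_rescale, PowerSeries.coeff_exp, div_eq_mul_inv]

theorem derivative_expNeg (a : ℝ) :
    PowerSeries.derivative ℝ (expNeg a) = -PowerSeries.C a * expNeg a := by
  ext n
  rw [PowerSeries.coeff_derivative, neg_mul, map_neg, PowerSeries.coeff_C_mul, coeff_expNeg,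
    coeff_expNeg, Nat.factorial_succ]
  have := Nat.factorial_ne_zero n
  push_cast
  field_simp
  ring

theorem Lmat_zero_eq_toeplitz (N : ℕ) (a : ℝ) (μ : ℕ → ℝ) :
    Lmat N a μ 0 = toeplitz N μ (expNeg a) := by
  ext j k
  simp only [Lmat, toeplitz, Matrix.of_apply, charlier_zero_right, coeff_expNeg]
  split_ifs
  · push_cast; ring
  · rfl

theorem isUnit_Lmat_zero {N : ℕ} (a : ℝ) {μ : ℕ → ℝ}
    (hμ : ∀ j : ℕ, 1 ≤ j → j ≤ N → 0 < μ j) : IsUnit (Lmat N a μ 0) := by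
  have h : IsUnit (expNeg a) :=
    (PowerSeries.isUnit_exp ℝ).map (PowerSeries.rescale (-a))
  obtain ⟨g, hg⟩ := h.exists_right_inv
  refine IsUnit.of_mul_eq_one (toeplitz N μ g) ?_
  rw [Lmat_zero_eq_toeplitz, ← toeplitz_mul hμ, hg, toeplitz_one hμ]

/-- The normalized Charlier polynomials `(-a)^m c_m^{(a)}(x) / m!` at `x ∈ ℕ₀`, given as the
coefficients of their generating function `exp(-a t) (1 + t)^x`. -/
def charlierCoeff (a : ℝ) (m x : ℕ) : ℝ :=
  PowerSeries.coeff m (expNeg a * (1 + PowerSeries.X) ^ x)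

theorem charlierCoeff_zero_left (a : ℝ) (x : ℕ) : charlierCoeff a 0 x = 1 := by
  have h : PowerSeries.constantCoeff (expNeg a) = 1 := by
    rw [← PowerSeries.coeff_zero_eq_constantCoeff_apply, coeff_expNeg]
    simp
  simp [charlierCoeff, h]

theorem charlierCoeff_succ_succ (a : ℝ) (m x : ℕ) :
    charlierCoeff a (m + 1) (x + 1) = charlierCoeff a (m + 1) x + charlierCoeff a m x := by
  rw [charlierCoeff, pow_succ, ← mul_assoc, mul_add, mul_one, map_add,
    PowerSeries.coeff_succ_mul_X]
  rfl

theorem succ_mul_charlierCoeff_succ (a : ℝ) (m x : ℕ) :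
    (m + 1) * charlierCoeff a (m + 1) x =
      x * charlierCoeff a m (x - 1) - a * charlierCoeff a m x := by
  have h : PowerSeries.derivative ℝ (expNeg a * (1 + PowerSeries.X) ^ x) =
      PowerSeries.C (x : ℝ) * (expNeg a * (1 + PowerSeries.X) ^ (x - 1))
        - PowerSeries.C a * (expNeg a * (1 + PowerSeries.X) ^ x) := by
    rw [Derivation.leibniz, Derivation.leibniz_pow, derivative_expNeg, map_add,
      PowerSeries.derivative_X, PowerSeries.derivative_one]
    simp only [smul_eq_mul, nsmul_eq_mul, map_natCast]
    ring
  have h' := congrArg (PowerSeries.coeff m) h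
  rw [PowerSeries.coeff_derivative, map_sub, PowerSeries.coeff_C_mul,
    PowerSeries.coeff_C_mul] at h'
  rw [mul_comm]
  exact h'

theorem abs_charlierCoeff_le (a : ℝ) (m x : ℕ) :
    |charlierCoeff a m x| ≤ Real.exp |a| * 2 ^ x := by
  induction x generalizing m with
  | zero =>
    rw [charlierCoeff, pow_zero, mul_one, coeff_expNeg, pow_zero, mul_one, abs_div, abs_pow,
      abs_neg, Nat.abs_cast]
    exact Real.pow_div_factorial_le_exp _ (abs_nonneg a) m
  | succ x ih =>
    cases m with
    | zero =>
      rw [charlierCoeff_zero_left, abs_one]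
      exact one_le_mul_of_one_le_of_one_le (Real.one_le_exp (abs_nonneg a))
        (one_le_pow₀ one_le_two)
    | succ m =>
      rw [charlierCoeff_succ_succ, pow_succ]
      linarith [abs_add_le (charlierCoeff a (m + 1) x) (charlierCoeff a m x), ih m, ih (m + 1)]

theorem summable_charlierCoeff_mul (a : ℝ) (m n : ℕ) :
    Summable fun x : ℕ =>
      a ^ x / x.factorial * (charlierCoeff a m x * charlierCoeff a n x) := by
  refine Summable.of_norm_bounded
    ((Real.summable_pow_div_factorial (4 * |a|)).mul_left (Real.exp |a| ^ 2)) fun x => ?_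
  have h := mul_le_mul (abs_charlierCoeff_le a m x) (abs_charlierCoeff_le a n x)
    (abs_nonneg _) (by positivity)
  have h4 : (4 : ℝ) ^ x = 2 ^ x * 2 ^ x := by rw [← mul_pow]; norm_num
  rw [Real.norm_eq_abs, abs_mul, abs_mul, abs_div, abs_pow, Nat.abs_cast]
  calc |a| ^ x / x.factorial * (|charlierCoeff a m x| * |charlierCoeff a n x|)
      ≤ |a| ^ x / x.factorial * (Real.exp |a| * 2 ^ x * (Real.exp |a| * 2 ^ x)) := by gcongr
    _ = Real.exp |a| ^ 2 * ((4 * |a|) ^ x / x.factorial) := by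
      rw [mul_pow, h4]; ring

/-- Lowering one degree: the ladder relation for the Charlier inner products. -/
theorem succ_mul_tsum_charlierCoeff (a : ℝ) (m n : ℕ) :
    (m + 1) * ∑' x : ℕ,
        a ^ x / x.factorial * (charlierCoeff a (m + 1) x * charlierCoeff a n x) =
      a * ∑' x : ℕ,
        a ^ x / x.factorial * (charlierCoeff a m x *
          (charlierCoeff a n (x + 1) - charlierCoeff a n x)) := by
  have hs := summable_charlierCoeff_mul a
  let u : ℕ → ℝ := fun x => a ^ x / x.factorial *
    (x * charlierCoeff a m (x - 1) * charlierCoeff a n x)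
  have hu : ∀ x, u x = (m + 1) * (a ^ x / x.factorial *
        (charlierCoeff a (m + 1) x * charlierCoeff a n x))
      + a * (a ^ x / x.factorial * (charlierCoeff a m x * charlierCoeff a n x)) := by
    intro x
    simp only [u]
    linear_combination (-(a ^ x / x.factorial) * charlierCoeff a n x) *
      succ_mul_charlierCoeff_succ a m x
  have hu' : ∀ x, u (x + 1) =
      a * (a ^ x / x.factorial * (charlierCoeff a m x *
          (charlierCoeff a n (x + 1) - charlierCoeff a n x)))
      + a * (a ^ x / x.factorial * (charlierCoeff a m x * charlierCoeff a n x)) := by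
    intro x
    have := Nat.factorial_ne_zero x
    simp only [u, Nat.factorial_succ, Nat.add_sub_cancel]
    push_cast
    field_simp
    ring
  have hu0 : u 0 = 0 := by simp [u]
  have hd : Summable fun x : ℕ => a ^ x / x.factorial * (charlierCoeff a m x *
      (charlierCoeff a n (x + 1) - charlierCoeff a n x)) := by
    cases n with
    | zero => simp [charlierCoeff_zero_left]
    | succ n => simpa [charlierCoeff_succ_succ] using hs m n
  have h₁ : Summable u := by
    simp_rw [funext hu]
    exact ((hs (m + 1) n).mul_left _).add ((hs m n).mul_left _)
  have h₂ := h₁.tsum_eq_zero_add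
  rw [hu0, zero_add] at h₂
  simp_rw [hu', hu] at h₂
  rw [((hs (m + 1) n).mul_left _).tsum_add ((hs m n).mul_left _),
    (hd.mul_left _).tsum_add ((hs m n).mul_left _), tsum_mul_left, tsum_mul_left,
    tsum_mul_left] at h₂
  linarith

theorem tsum_charlierCoeff_mul (a : ℝ) (m n : ℕ) :
    ∑' x : ℕ, a ^ x / x.factorial * (charlierCoeff a m x * charlierCoeff a n x) =
      if m = n then Real.exp a * (a ^ m / m.factorial) else 0 := by
  have hzero : ∀ k, ∑' x : ℕ, a ^ x / x.factorial *
      (charlierCoeff a (k + 1) x * charlierCoeff a 0 x) = 0 := by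
    intro k
    have h := succ_mul_tsum_charlierCoeff a k 0
    simp only [charlierCoeff_zero_left a, sub_self, mul_zero, tsum_zero] at h ⊢
    exact (mul_eq_zero.1 h).resolve_left (by positivity)
  induction m generalizing n with
  | zero =>
    cases n with
    | zero =>
      simp only [charlierCoeff_zero_left, mul_one, if_true, pow_zero, Nat.factorial_zero,
        Nat.cast_one, div_one, Real.exp_eq_exp_ℝ, NormedSpace.exp_eq_tsum_div]
    | succ n =>
      rw [if_neg (by omega), ← hzero n]
      simp_rw [mul_comm (charlierCoeff a 0 _)]
  | succ m ih =>
    cases n with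
    | zero => rw [if_neg (by omega), hzero]
    | succ n =>
      have h := succ_mul_tsum_charlierCoeff a m (n + 1)
      simp only [charlierCoeff_succ_succ, add_sub_cancel_left] at h
      rw [ih n] at h
      have hm : (m + 1 : ℝ) ≠ 0 := by positivity
      apply mul_left_cancel₀ hm
      rw [h]
      have := Nat.factorial_ne_zero m
      by_cases hmn : m = n
      · rw [if_pos hmn, if_pos (by omega), Nat.factorial_succ]
        push_cast
        field_simp
        ring
      · rw [if_neg hmn, if_neg (by omega), mul_zero, mul_zero]

theorem hasSum_charlierCoeff_mul (a : ℝ) (m n : ℕ) :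
    HasSum (fun x : ℕ => a ^ x / x.factorial * (charlierCoeff a m x * charlierCoeff a n x))
      (if m = n then Real.exp a * (a ^ m / m.factorial) else 0) :=
  tsum_charlierCoeff_mul a m n ▸ (summable_charlierCoeff_mul a m n).hasSum

/-- Summing the Charlier part of the weight gives the diagonal factor of the zeroth moment. -/
theorem hasSum_toeplitz_mul_Tmat_mul {N : ℕ} {a : ℝ} (ha : a ≠ 0) (μ δ : ℕ → ℝ) :
    HasSum (fun x : ℕ => ((a ^ x / x.factorial : ℝ) : ℂ) •
        (toeplitz N μ (expNeg a * (1 + PowerSeries.X) ^ x) * Tmat N δ *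
          (toeplitz N μ (expNeg a * (1 + PowerSeries.X) ^ x))ᴴ))
      (Matrix.diagonal (fun j : Fin N =>
        ((μ ((j : ℕ) + 1) : ℝ) : ℂ) ^ 2 * (a : ℂ) ^ ((j : ℕ) + 1)
          * Complex.exp (a : ℂ)
          * ∑ l ∈ Finset.Icc 1 ((j : ℕ) + 1),
              ((δ l / (μ l) ^ 2 : ℝ) : ℂ) * (a : ℂ) ^ (-(l : ℤ))
                / (((((j : ℕ) + 1) - l).factorial) : ℂ))) := by
  refine Pi.hasSum.2 fun j => Pi.hasSum.2 fun k => ?_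
  let G : ℕ → ℂ := fun l => if l ∈ Finset.Iic (j : ℕ) then
    ((μ (j + 1) ^ 2 * (δ (l + 1) / μ (l + 1) ^ 2) *
      (Real.exp a * (a ^ (j - l : ℕ) / ((j - l : ℕ).factorial : ℝ))) : ℝ) : ℂ) else 0
  have hterm : ∀ l : Fin N, HasSum (fun x : ℕ => ((a ^ x / x.factorial : ℝ) : ℂ) *
      (toeplitz N μ (expNeg a * (1 + PowerSeries.X) ^ x) j l * ((δ (l + 1) : ℝ) : ℂ) *
        star (toeplitz N μ (expNeg a * (1 + PowerSeries.X) ^ x) k l)))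
      (if j = k then G l else 0) := by
    intro l
    by_cases h₁ : (l : ℕ) ≤ j
    swap
    · convert hasSum_zero using 1
      · simp [toeplitz_apply_eq_zero h₁]
      · simp [G, h₁]
    by_cases h₂ : (l : ℕ) ≤ k
    swap
    · have : j ≠ k := by rintro rfl; exact h₂ h₁
      convert hasSum_zero using 1
      · simp [toeplitz_apply_eq_zero h₂]
      · simp [this]
    have h := (hasSum_charlierCoeff_mul a (j - l) (k - l)).mul_left
      (μ (j + 1) / μ (l + 1) * δ (l + 1) * (μ (k + 1) / μ (l + 1)))
    have h' := Complex.hasSum_ofReal.2 h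
    convert h' using 1
    · funext x
      simp only [toeplitz, Matrix.of_apply, h₁, h₂, if_true, Complex.star_def,
        Complex.conj_ofReal, charlierCoeff, ← Complex.ofReal_mul]
      congr 1
      ring
    · by_cases hjk : j = k
      · subst hjk
        simp only [G, if_true, Finset.mem_Iic, h₁]
        congr 1
        ring
      · have : (j : ℕ) - l ≠ k - l := fun h => hjk (Fin.ext (by omega))
        simp [hjk, this]
  have hsum := hasSum_sum fun l (_ : l ∈ Finset.univ) => hterm l
  convert hsum using 1
  · funext x
    rw [Matrix.smul_apply, Matrix.mul_apply, smul_eq_mul, Finset.mul_sum]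
    refine Finset.sum_congr rfl fun l _ => ?_
    rw [Tmat, Matrix.mul_diagonal, Matrix.conjTranspose_apply]
  · by_cases hjk : j = k
    · subst hjk
      simp only [if_true, Matrix.diagonal_apply_eq]
      rw [Fin.sum_univ_eq_sum_range G,
        Finset.sum_ite_mem, Finset.inter_eq_right.2 (fun l hl => by
          simp only [Finset.mem_Iic, Finset.mem_range] at *; omega), Finset.mul_sum]
      symm
      refine Finset.sum_nbij' (· + 1) (· - 1) ?_ ?_ ?_ ?_ ?_
      · intro l hl
        simp only [Finset.mem_Iic, Finset.mem_Icc] at *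
        omega
      · intro l hl
        simp only [Finset.mem_Iic, Finset.mem_Icc] at *
        omega
      · intro l _
        exact Nat.add_sub_cancel l 1
      · intro l hl
        simp only [Finset.mem_Icc] at hl
        exact Nat.sub_add_cancel hl.1
      · intro l hl
        simp only [Finset.mem_Iic] at hl
        have ha' : (a : ℂ) ≠ 0 := Complex.ofReal_ne_zero.2 ha
        have hpow : (a : ℂ) ^ (j - l : ℕ) =
            (a : ℂ) ^ ((j : ℕ) + 1) * (a : ℂ) ^ (-((l + 1 : ℕ) : ℤ)) := by
          rw [← zpow_natCast, ← zpow_natCast, ← zpow_add₀ ha']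
          congr 1
          omega
        rw [Nat.add_sub_add_right]
        push_cast at hpow ⊢
        rw [hpow]
        ring
    · simp [hjk]

/-- The weight at `x` as a congruence transform of its Charlier generating function part. -/
theorem Wch_eq {N : ℕ} (a : ℝ) {μ : ℕ → ℝ} (hμ : ∀ j : ℕ, 1 ≤ j → j ≤ N → 0 < μ j)
    (δ : ℕ → ℝ) (lam x : ℕ) :
    Wch N a μ δ lam x = (Lmat N a μ 0)⁻¹ * (1 + Amat N μ) ^ lam *
      (((a ^ x / x.factorial : ℝ) : ℂ) •
        (toeplitz N μ (expNeg a * (1 + PowerSeries.X) ^ x) * Tmat N δ *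
          (toeplitz N μ (expNeg a * (1 + PowerSeries.X) ^ x))ᴴ)) *
      ((1 + (Amat N μ)ᴴ) ^ lam * ((Lmat N a μ 0)ᴴ)⁻¹) := by
  have hU : (Lmat N a μ 0)⁻¹ * (1 + Amat N μ) ^ lam *
      toeplitz N μ (expNeg a * (1 + PowerSeries.X) ^ x) = (1 + Amat N μ) ^ (x + lam) := by
    have h : (1 + Amat N μ) ^ lam * toeplitz N μ (expNeg a * (1 + PowerSeries.X) ^ x) =
        Lmat N a μ 0 * (1 + Amat N μ) ^ (x + lam) := by
      rw [one_add_Amat_eq_toeplitz hμ, Lmat_zero_eq_toeplitz, ← toeplitz_pow hμ,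
        ← toeplitz_pow hμ, ← toeplitz_mul hμ, ← toeplitz_mul hμ]
      congr 1
      ring
    rw [mul_assoc, h, Matrix.nonsing_inv_mul_cancel_left _ _
      ((Matrix.isUnit_iff_isUnit_det _).1 (isUnit_Lmat_zero a hμ))]
  have hU' := congrArg Matrix.conjTranspose hU
  simp only [Matrix.conjTranspose_mul, Matrix.conjTranspose_pow, Matrix.conjTranspose_add,
    Matrix.conjTranspose_one, Matrix.conjTranspose_nonsing_inv] at hU'
  rw [Wch, ← hU, ← hU']
  simp only [Matrix.mul_smul, Matrix.smul_mul, mul_assoc]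

/-- the LDU factorization of the zeroth moment of the matrix Charlier
weight, with entrywise absolutely convergent series. -/
theorem zeroth_moment_LDU (N : ℕ) (hN : 1 ≤ N) (a : ℝ) (ha : 0 < a)
    (μ : ℕ → ℝ) (hμ : ∀ j : ℕ, 1 ≤ j → j ≤ N → 0 < μ j)
    (δ : ℕ → ℕ → ℝ) (hδ : ∀ lam k : ℕ, 1 ≤ k → k ≤ N → 0 < δ lam k) :
    ∀ lam : ℕ,
      (∀ i j : Fin N, Summable fun x : ℕ => ‖Wch N a μ (δ lam) lam x i j‖) ∧
      (∑' x : ℕ, Wch N a μ (δ lam) lam x)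
        = (Lmat N a μ 0)⁻¹ * (1 + Amat N μ) ^ lam
            * Matrix.diagonal (fun j : Fin N =>
                ((μ ((j : ℕ) + 1) : ℝ) : ℂ) ^ 2 * (a : ℂ) ^ ((j : ℕ) + 1)
                  * Complex.exp (a : ℂ)
                  * ∑ l ∈ Finset.Icc 1 ((j : ℕ) + 1),
                      ((δ lam l / (μ l) ^ 2 : ℝ) : ℂ) * (a : ℂ) ^ (-(l : ℤ))
                        / (((((j : ℕ) + 1) - l).factorial) : ℂ))
            * (1 + (Amat N μ)ᴴ) ^ lam * ((Lmat N a μ 0)ᴴ)⁻¹ := by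
  intro lam
  have hsum := ((hasSum_toeplitz_mul_Tmat_mul (N := N) ha.ne' μ (δ lam)).mul_left
    ((Lmat N a μ 0)⁻¹ * (1 + Amat N μ) ^ lam)).mul_right
      ((1 + (Amat N μ)ᴴ) ^ lam * ((Lmat N a μ 0)ᴴ)⁻¹)
  simp only [← Wch_eq a hμ (δ lam) lam] at hsum
  refine ⟨fun i j => ?_, ?_⟩
  · exact (Pi.summable.1 (Pi.summable.1 hsum.summable i) j).norm
  · rw [hsum.tsum_eq]
    simp only [mul_assoc]
end
end
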